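/- arXiv:1212.4681 — 13 statements merged into one kernel-verified Lean document; each statement's English description precedes it below -/
import Mathlib

section
/- Let p, q ∈ (1, ∞). For every x ∈ (0, 1), one has arcsin_{p,q}(x) > p·x·(1 - x^q)^{1 - 1/p} / ((q - p)·x^q + p). -/
open MeasureTheory Set

/-- The generalized inverse sine dominates the identity on `[0, 1)`. -/
theorem le_integral_one_sub_rpow {p q x : ℝ} (hp : 0 < p) (hq : 0 < q) (hx0 : 0 ≤ x)
    (hx1 : x < 1) : x ≤ ∫ t in (0:ℝ)..x, (1 - t ^ q) ^ (-(1 / p)) := by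
  have hpos : ∀ t ∈ Icc 0 x, 0 < 1 - t ^ q := fun t ht =>
    sub_pos.2 (Real.rpow_lt_one ht.1 (ht.2.trans_lt hx1) hq)
  have hcont : ContinuousOn (fun t : ℝ => (1 - t ^ q) ^ (-(1 / p))) (uIcc 0 x) := by
    rw [uIcc_of_le hx0]
    refine ContinuousOn.rpow_const ?_ fun t ht => Or.inl (hpos t ht).ne'
    exact continuousOn_const.sub (continuousOn_id.rpow_const fun t _ => Or.inr hq.le)
  have hmono := intervalIntegral.integral_mono_on (μ := volume) (f := fun _ => (1 : ℝ)) hx0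
    intervalIntegrable_const hcont.intervalIntegrable fun t ht =>
      Real.one_le_rpow_of_pos_of_le_one_of_nonpos (hpos t ht)
        (sub_le_self 1 (Real.rpow_nonneg ht.1 q)) (neg_nonpos.2 (one_div_pos.2 hp).le)
  simpa using hmono

/-- Lemma 2.1: for `p, q ∈ (1, ∞)` and `x ∈ (0,1)`,
`arcsin_{p,q}(x) > p x (1 - x^q)^(1-1/p) / ((q-p) x^q + p)`,
where `arcsin_{p,q}(x) = ∫₀ˣ (1 - t^q)^(-1/p) dt`. -/
theorem arcsin_pq_lower_bound (p q : ℝ) (hp : 1 < p) (hq : 1 < q)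
    (x : ℝ) (hx : x ∈ Set.Ioo (0 : ℝ) 1) :
    (∫ t in (0:ℝ)..x, (1 - t ^ q) ^ (-(1 / p))) >
      p * x * (1 - x ^ q) ^ (1 - 1 / p) / ((q - p) * x ^ q + p) := by
  have hp0 : 0 < p := one_pos.trans hp
  have hq0 : 0 < q := one_pos.trans hq
  refine lt_of_lt_of_le ?_ (le_integral_one_sub_rpow hp0 hq0 hx.1.le hx.2)
  have hy0 : 0 < x ^ q := Real.rpow_pos_of_pos hx.1 q
  have hy1 : x ^ q < 1 := Real.rpow_lt_one hx.1.le hx.2 hq0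
  generalize x ^ q = y at hy0 hy1 ⊢
  have hD : 0 < (q - p) * y + p := by nlinarith [mul_pos hq0 hy0]
  have hinv : 1 / p ≤ 1 := (div_le_one hp0).2 hp.le
  have hbern : (1 - y) ^ (1 - 1 / p) ≤ 1 - (1 - 1 / p) * y := by
    simpa [sub_eq_add_neg] using rpow_one_add_le_one_add_mul_self
      (s := -y) (by linarith) (sub_nonneg.2 hinv) (sub_le_self 1 (one_div_pos.2 hp0).le)
  have hmul : p * (1 - y) ^ (1 - 1 / p) ≤ p - (p - 1) * y :=
    (mul_le_mul_of_nonneg_left hbern hp0.le).trans_eq (by field_simp)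
  have hlt : p * (1 - y) ^ (1 - 1 / p) < (q - p) * y + p := by
    nlinarith [mul_pos (sub_pos.2 hq) hy0]
  rw [div_lt_iff₀ hD]
  nlinarith [mul_lt_mul_of_pos_left hlt hx.1]
end

section
/- Let p, q ∈ (1, ∞). For every x ∈ (0, ∞), one has x / arcsinh_{p,q}(x) > ((p - q)·x^q + p) / (p·(1 + x^q)^{1 - 1/p}). -/
open MeasureTheory Set

lemma hasDerivAt_mul_one_add_rpow_div {a q t : ℝ} (ht : 0 < t)
    (hc : 0 < 1 + (1 - q * a) * t ^ q) :
    HasDerivAt (fun s : ℝ => s * (1 + s ^ q) ^ (1 - a) / (1 + (1 - q * a) * s ^ q))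
      ((1 + t ^ q) ^ (-a) +
        q ^ 2 * a * t ^ q * (1 + t ^ q) ^ (-a) / (1 + (1 - q * a) * t ^ q) ^ 2) t := by
  have hy : 0 < t ^ q := Real.rpow_pos_of_pos ht q
  have h1 : 0 < 1 + t ^ q := by linarith
  have hpow : HasDerivAt (fun s : ℝ => s ^ q) (q * t ^ (q - 1)) t :=
    Real.hasDerivAt_rpow_const (Or.inl ht.ne')
  have hadd := (hpow.const_add 1).rpow_const (p := 1 - a) (Or.inl h1.ne')
  have hden := (hpow.const_mul (1 - q * a)).const_add 1
  refine (((hasDerivAt_id' t).fun_mul hadd).fun_div hden hc.ne').congr_deriv ?_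
  have e1 : (1 + t ^ q) ^ (1 - a) = (1 + t ^ q) * (1 + t ^ q) ^ (-a) := by
    rw [sub_eq_add_neg, Real.rpow_add h1, Real.rpow_one]
  have e2 : (1 : ℝ) - a - 1 = -a := by ring
  have e3 : t ^ (q - 1) = t ^ q / t := by rw [Real.rpow_sub ht, Real.rpow_one]
  rw [e2, e1, e3]
  generalize (1 + t ^ q) ^ (-a) = w
  generalize t ^ q = y at *
  have hc' : 1 + y * (1 - q * a) ≠ 0 := by rw [mul_comm y]; exact hc.ne'
  field_simp
  ring

lemma continuousOn_one_add_rpow_rpow {q : ℝ} (hq : 0 ≤ q) (b : ℝ) :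
    ContinuousOn (fun t : ℝ => (1 + t ^ q) ^ b) (Ici 0) := by
  refine ContinuousOn.rpow_const
    (continuousOn_const.add (continuousOn_id.rpow_const fun _ _ => Or.inr hq)) fun t ht => ?_
  have : 0 ≤ t ^ q := Real.rpow_nonneg ht q
  exact Or.inl (by linarith)

lemma intervalIntegrable_one_add_rpow_rpow {q x : ℝ} (hq : 0 ≤ q) (hx : 0 ≤ x) (b : ℝ) :
    IntervalIntegrable (fun t : ℝ => (1 + t ^ q) ^ b) volume 0 x :=
  ((continuousOn_one_add_rpow_rpow hq b).mono
    (by rw [uIcc_of_le hx]; exact Icc_subset_Ici_self)).intervalIntegrable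

lemma hasDerivAt_integral_one_add_rpow_rpow {q t : ℝ} (hq : 0 ≤ q) (ht : 0 < t) (b : ℝ) :
    HasDerivAt (fun s : ℝ => ∫ u in (0 : ℝ)..s, (1 + u ^ q) ^ b) ((1 + t ^ q) ^ b) t := by
  refine intervalIntegral.integral_hasDerivAt_right
    (intervalIntegrable_one_add_rpow_rpow hq ht.le b) ?_
    ((continuousOn_one_add_rpow_rpow hq b).continuousAt (Ici_mem_nhds ht))
  exact Measurable.stronglyMeasurable (by fun_prop) |>.stronglyMeasurableAtFilter

lemma integral_one_add_rpow_rpow_lt {a q x : ℝ} (ha : 0 < a) (hq : 0 < q) (hx : 0 < x)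
    (hc : 0 < 1 + (1 - q * a) * x ^ q) :
    ∫ t in (0 : ℝ)..x, (1 + t ^ q) ^ (-a) <
      x * (1 + x ^ q) ^ (1 - a) / (1 + (1 - q * a) * x ^ q) := by
  have hpos : ∀ t ∈ Icc 0 x, 0 < 1 + (1 - q * a) * t ^ q := by
    intro t ht
    have h0 : 0 ≤ t ^ q := Real.rpow_nonneg ht.1 q
    have hle : t ^ q ≤ x ^ q := Real.rpow_le_rpow ht.1 ht.2 hq.le
    rcases le_total 0 (1 - q * a) with h | h
    · positivity
    · nlinarith [mul_le_mul_of_nonpos_left hle h]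
  have hmono : StrictMonoOn
      (fun s : ℝ => s * (1 + s ^ q) ^ (1 - a) / (1 + (1 - q * a) * s ^ q) -
        ∫ t in (0 : ℝ)..s, (1 + t ^ q) ^ (-a)) (Icc 0 x) := by
    refine strictMonoOn_of_deriv_pos (convex_Icc 0 x) ?_ fun t ht => ?_
    · refine ContinuousOn.sub (ContinuousOn.div (continuousOn_id.mul
        ((continuousOn_one_add_rpow_rpow hq.le _).mono Icc_subset_Ici_self))
        (continuousOn_const.add (continuousOn_const.mul
          (continuousOn_id.rpow_const fun _ _ => Or.inr hq.le)))
        fun t ht => (hpos t ht).ne') ?_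
      have h := intervalIntegral.continuousOn_primitive_interval'
        (intervalIntegrable_one_add_rpow_rpow hq.le hx.le (-a)) left_mem_uIcc
      rwa [uIcc_of_le hx.le] at h
    · rw [interior_Icc] at ht
      have hct := hpos t (Ioo_subset_Icc_self ht)
      have ht0 : 0 < t := ht.1
      rw [((hasDerivAt_mul_one_add_rpow_div ht0 hct).fun_sub
        (hasDerivAt_integral_one_add_rpow_rpow hq.le ht0 (-a))).deriv, add_sub_cancel_left]
      positivity
  have h := hmono (left_mem_Icc.2 hx.le) (right_mem_Icc.2 hx.le) hx
  simpa using h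

/-- Lemma 2.2: for `p, q ∈ (1, ∞)` and `x ∈ (0, ∞)`,
`x / arcsinh_{p,q}(x) > ((p-q) x^q + p) / (p (1 + x^q)^(1-1/p))`,
where `arcsinh_{p,q}(x) = ∫₀ˣ (1 + t^q)^(-1/p) dt`. -/
theorem arcsinh_pq_ratio_bound (p q : ℝ) (hp : 1 < p) (hq : 1 < q)
    (x : ℝ) (hx : 0 < x) :
    x / (∫ t in (0:ℝ)..x, (1 + t ^ q) ^ (-(1 / p))) >
      ((p - q) * x ^ q + p) / (p * (1 + x ^ q) ^ (1 - 1 / p)) := by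
  have hp0 : 0 < p := by linarith
  have hq0 : 0 < q := by linarith
  have hI : 0 < ∫ t in (0 : ℝ)..x, (1 + t ^ q) ^ (-(1 / p)) := by
    refine intervalIntegral.intervalIntegral_pos_of_pos_on
      (intervalIntegrable_one_add_rpow_rpow hq0.le hx.le _) (fun t ht => ?_) hx
    have ht0 : 0 < t := ht.1
    positivity
  have hD : 0 < (1 + x ^ q) ^ (1 - 1 / p) := by positivity
  have hnum : (p - q) * x ^ q + p = p * (1 + (1 - q * (1 / p)) * x ^ q) := by
    field_simp
    ring
  rw [gt_iff_lt, hnum, mul_div_mul_left _ _ hp0.ne']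
  rcases le_or_gt (1 + (1 - q * (1 / p)) * x ^ q) 0 with hc | hc
  · exact (div_nonpos_of_nonpos_of_nonneg hc hD.le).trans_lt (div_pos hx hI)
  · have h := integral_one_add_rpow_rpow_lt (one_div_pos.2 hp0) hq0 hx hc
    rw [lt_div_iff₀ hc] at h
    rw [div_lt_div_iff₀ hD hI]
    linarith
end

section
/- Let p, q ∈ (1, ∞). For all x, y ∈ (0, 1), one has arcsin_{p,q}(√(x·y)) ≤ √(arcsin_{p,q}(x) · arcsin_{p,q}(y)). -/
open MeasureTheory Set

/-- Cauchy–Schwarz for interval integrals: if `m ^ 2 ≤ g * h` pointwise, the same inequality holds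
between the integrals. -/
theorem sq_intervalIntegral_le_mul_of_sq_le_mul {a b : ℝ} (hab : a ≤ b) {m g h : ℝ → ℝ}
    (hm : IntervalIntegrable m volume a b) (hg : IntervalIntegrable g volume a b)
    (hh : IntervalIntegrable h volume a b) (hg0 : ∀ s ∈ Icc a b, 0 < g s)
    (H : ∀ s ∈ Icc a b, m s ^ 2 ≤ g s * h s) :
    (∫ s in a..b, m s) ^ 2 ≤ (∫ s in a..b, g s) * ∫ s in a..b, h s := by
  have key : ∀ c : ℝ, 0 ≤ (∫ s in a..b, g s) * (c * c) + (-2 * ∫ s in a..b, m s) * c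
      + ∫ s in a..b, h s := by
    intro c
    have h1 : 0 ≤ ∫ s in a..b, ((c * c) * g s + (-2 * c) * m s + h s) := by
      refine intervalIntegral.integral_nonneg hab fun s hs => ?_
      have hgs := hg0 s hs
      refine nonneg_of_mul_nonneg_right ?_ hgs
      nlinarith [sq_nonneg (c * g s - m s), H s hs]
    rw [intervalIntegral.integral_add ((hg.const_mul _).add (hm.const_mul _)) hh,
      intervalIntegral.integral_add (hg.const_mul _) (hm.const_mul _),
      intervalIntegral.integral_const_mul, intervalIntegral.integral_const_mul] at h1
    linarith
  have hd := discrim_le_zero key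
  rw [discrim] at hd
  linarith

theorem one_sub_mul_rpow_pos {q c s : ℝ} (hq : 0 < q) (hc : c ∈ Ioo (0 : ℝ) 1)
    (hs : s ∈ Icc (0 : ℝ) 1) : 0 < 1 - (s * c) ^ q := by
  have h : s * c < 1 := by nlinarith [hs.1, hs.2, hc.1, hc.2]
  linarith [Real.rpow_lt_one (mul_nonneg hs.1 hc.1.le) h hq]

theorem intervalIntegrable_one_sub_mul_rpow_rpow {q c : ℝ} (r : ℝ) (hq : 0 < q)
    (hc : c ∈ Ioo (0 : ℝ) 1) :
    IntervalIntegrable (fun s : ℝ => (1 - (s * c) ^ q) ^ r) volume 0 1 := by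
  refine ContinuousOn.intervalIntegrable ?_
  rw [uIcc_of_le zero_le_one]
  refine ContinuousOn.rpow_const ?_ fun s hs => Or.inl (one_sub_mul_rpow_pos hq hc hs).ne'
  exact continuousOn_const.sub
    ((continuous_id.mul continuous_const).continuousOn.rpow_const fun s _ => Or.inr hq.le)

/-- The map `t ↦ (1 - t ^ q) ^ (-r)` is multiplicatively midpoint convex. -/
theorem sq_one_sub_rpow_rpow_neg_le {q r a b w : ℝ} (hr : 0 ≤ r)
    (ha : 0 ≤ a) (hb : 0 ≤ b) (hw : 0 ≤ w) (hwab : w ^ 2 = a * b)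
    (ha1 : 0 < 1 - a ^ q) (hb1 : 0 < 1 - b ^ q) (hw1 : 0 < 1 - w ^ q) :
    ((1 - w ^ q) ^ (-r)) ^ 2 ≤ (1 - a ^ q) ^ (-r) * (1 - b ^ q) ^ (-r) := by
  rw [← Real.mul_rpow ha1.le hb1.le, sq, ← Real.mul_rpow hw1.le hw1.le]
  refine Real.rpow_le_rpow_of_nonpos (mul_pos ha1 hb1) ?_ (neg_nonpos.2 hr)
  have h : w ^ q * w ^ q = a ^ q * b ^ q := by
    rw [← Real.mul_rpow hw hw, ← Real.mul_rpow ha hb, ← hwab, sq]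
  have hA := Real.rpow_nonneg ha q
  have hB := Real.rpow_nonneg hb q
  have h2 : 2 * w ^ q ≤ a ^ q + b ^ q := by
    refine abs_le_of_sq_le_sq' ?_ (by positivity) |>.2
    nlinarith [sq_nonneg (a ^ q - b ^ q)]
  nlinarith

/-- Inequality (2.14) with `p₁ = 0`: for `p, q ∈ (1, ∞)` and `x, y ∈ (0, 1)`,
`arcsin_{p,q}(√(xy)) ≤ √(arcsin_{p,q}(x) · arcsin_{p,q}(y))`,
where `arcsin_{p,q}(x) = ∫₀ˣ (1 - t^q)^(-1/p) dt`. -/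
theorem arcsin_pq_geom_mean (p q : ℝ) (hp : 1 < p) (hq : 1 < q)
    (x y : ℝ) (hx : x ∈ Set.Ioo (0 : ℝ) 1) (hy : y ∈ Set.Ioo (0 : ℝ) 1) :
    (∫ t in (0:ℝ)..Real.sqrt (x * y), (1 - t ^ q) ^ (-(1 / p))) ≤
      Real.sqrt ((∫ t in (0:ℝ)..x, (1 - t ^ q) ^ (-(1 / p))) *
        (∫ t in (0:ℝ)..y, (1 - t ^ q) ^ (-(1 / p)))) := by
  have hq0 : 0 < q := by linarith
  have hxy : 0 < x * y := mul_pos hx.1 hy.1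
  have hw2 : Real.sqrt (x * y) ^ 2 = x * y := Real.sq_sqrt hxy.le
  have hw : Real.sqrt (x * y) ∈ Ioo (0 : ℝ) 1 := by
    refine ⟨Real.sqrt_pos.2 hxy, ?_⟩
    rw [Real.sqrt_lt' one_pos]
    nlinarith [hx.1, hx.2, hy.1, hy.2]
  have hsub : ∀ c : ℝ, (∫ t in (0:ℝ)..c, (1 - t ^ q) ^ (-(1 / p))) =
      c * ∫ s in (0:ℝ)..1, (1 - (s * c) ^ q) ^ (-(1 / p)) := fun c => by
    rw [intervalIntegral.mul_integral_comp_mul_right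
      (f := fun t : ℝ => (1 - t ^ q) ^ (-(1 / p))), zero_mul, one_mul]
  have hCS := sq_intervalIntegral_le_mul_of_sq_le_mul zero_le_one
    (intervalIntegrable_one_sub_mul_rpow_rpow (-(1 / p)) hq0 hw)
    (intervalIntegrable_one_sub_mul_rpow_rpow (-(1 / p)) hq0 hx)
    (intervalIntegrable_one_sub_mul_rpow_rpow (-(1 / p)) hq0 hy)
    (fun s hs => Real.rpow_pos_of_pos (one_sub_mul_rpow_pos hq0 hx hs) _)
    (fun s hs => sq_one_sub_rpow_rpow_neg_le (by positivity) (mul_nonneg hs.1 hx.1.le)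
      (mul_nonneg hs.1 hy.1.le) (mul_nonneg hs.1 hw.1.le) (by rw [mul_pow, hw2]; ring)
      (one_sub_mul_rpow_pos hq0 hx hs) (one_sub_mul_rpow_pos hq0 hy hs)
      (one_sub_mul_rpow_pos hq0 hw hs))
  apply Real.le_sqrt_of_sq_le
  rw [hsub (Real.sqrt (x * y)), hsub x, hsub y, mul_pow, hw2, mul_mul_mul_comm]
  exact mul_le_mul_of_nonneg_left hCS hxy.le
end

section
/- Let p, q ∈ (1, ∞). For x, y ∈ (0, 1), equality holds in arcsin_{p,q}(√(x·y)) ≤ √(arcsin_{p,q}(x) · arcsin_{p,q}(y)) if and only if x = y; in particular, if x ≠ y then arcsin_{p,q}(√(x·y)) < √(arcsin_{p,q}(x) · arcsin_{p,q}(y)). -/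
open MeasureTheory Set

/-- The integrand of `arcsin_{p,q}` is strictly geometrically convex on `(0, 1)`. -/
theorem sq_one_sub_rpow_sqrt_mul_lt {r q a b : ℝ} (hr : r < 0) (hq : 0 < q)
    (ha : a ∈ Set.Ioo (0 : ℝ) 1) (hb : b ∈ Set.Ioo (0 : ℝ) 1) (hab : a ≠ b) :
    ((1 - Real.sqrt (a * b) ^ q) ^ r) ^ 2 < (1 - a ^ q) ^ r * (1 - b ^ q) ^ r := by
  have hA : a ^ q < 1 := Real.rpow_lt_one ha.1.le ha.2 hq
  have hB : b ^ q < 1 := Real.rpow_lt_one hb.1.le hb.2 hq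
  have hz1 : Real.sqrt (a * b) < 1 := by
    rw [Real.sqrt_lt' one_pos]
    nlinarith [ha.1, ha.2, hb.1, hb.2]
  have hZ : Real.sqrt (a * b) ^ q < 1 := Real.rpow_lt_one (Real.sqrt_nonneg _) hz1 hq
  have hZ0 : 0 ≤ Real.sqrt (a * b) ^ q := Real.rpow_nonneg (Real.sqrt_nonneg _) _
  have hsq : (Real.sqrt (a * b) ^ q) ^ 2 = a ^ q * b ^ q := by
    rw [sq, ← Real.mul_rpow (Real.sqrt_nonneg _) (Real.sqrt_nonneg _),
      Real.mul_self_sqrt (mul_pos ha.1 hb.1).le, Real.mul_rpow ha.1.le hb.1.le]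
  have hne : a ^ q ≠ b ^ q := fun h => hab ((Real.rpow_left_inj ha.1.le hb.1.le hq.ne').1 h)
  have h_amgm : 2 * Real.sqrt (a * b) ^ q < a ^ q + b ^ q := by
    refine lt_of_pow_lt_pow_left₀ 2 (add_nonneg (Real.rpow_nonneg ha.1.le _)
      (Real.rpow_nonneg hb.1.le _)) ?_
    nlinarith [sq_pos_of_ne_zero (sub_ne_zero.2 hne)]
  rw [← Real.mul_rpow (sub_pos.2 hA).le (sub_pos.2 hB).le, sq,
    ← Real.mul_rpow (sub_pos.2 hZ).le (sub_pos.2 hZ).le]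
  refine Real.rpow_lt_rpow_of_neg (mul_pos (sub_pos.2 hA) (sub_pos.2 hB)) ?_ hr
  nlinarith

theorem continuousOn_one_sub_mul_rpow {r q c : ℝ} (hq : 0 < q) (hc : c ∈ Set.Ioo (0 : ℝ) 1) :
    ContinuousOn (fun s : ℝ => (1 - (c * s) ^ q) ^ r) (Set.Icc 0 1) := by
  have h : Continuous fun s : ℝ => 1 - (c * s) ^ q :=
    continuous_const.sub ((continuous_const.mul continuous_id).rpow_const fun _ => Or.inr hq.le)
  refine h.continuousOn.rpow_const fun s hs => Or.inl (sub_pos.2 ?_).ne'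
  exact Real.rpow_lt_one (mul_nonneg hc.1.le hs.1) (by nlinarith [hc.1, hc.2, hs.1, hs.2]) hq

theorem integral_one_sub_mul_rpow_pos {r q c : ℝ} (hq : 0 < q) (hc : c ∈ Set.Ioo (0 : ℝ) 1) :
    0 < ∫ s in (0:ℝ)..1, (1 - (c * s) ^ q) ^ r := by
  refine intervalIntegral.intervalIntegral_pos_of_pos_on
    ((continuousOn_one_sub_mul_rpow hq hc).intervalIntegrable_of_Icc zero_le_one) ?_ one_pos
  intro s hs
  refine Real.rpow_pos_of_pos (sub_pos.2 ?_) _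
  exact Real.rpow_lt_one (mul_nonneg hc.1.le hs.1.le) (by nlinarith [hc.1, hc.2, hs.1, hs.2]) hq

theorem integral_one_sub_rpow_eq_mul (r q c : ℝ) :
    ∫ t in (0:ℝ)..c, (1 - t ^ q) ^ r = c * ∫ s in (0:ℝ)..1, (1 - (c * s) ^ q) ^ r := by
  have h := intervalIntegral.mul_integral_comp_mul_left (a := 0) (b := 1)
    (f := fun t : ℝ => (1 - t ^ q) ^ r) c
  simpa using h.symm

theorem integral_one_sub_rpow_sqrt_mul_lt {r q x y : ℝ} (hr : r < 0) (hq : 0 < q)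
    (hx : x ∈ Set.Ioo (0 : ℝ) 1) (hy : y ∈ Set.Ioo (0 : ℝ) 1) (hxy : x ≠ y) :
    (∫ t in (0:ℝ)..Real.sqrt (x * y), (1 - t ^ q) ^ r) <
      Real.sqrt ((∫ t in (0:ℝ)..x, (1 - t ^ q) ^ r) * (∫ t in (0:ℝ)..y, (1 - t ^ q) ^ r)) := by
  have hz : Real.sqrt (x * y) ∈ Set.Ioo (0 : ℝ) 1 := by
    refine ⟨Real.sqrt_pos.2 (mul_pos hx.1 hy.1), ?_⟩
    rw [Real.sqrt_lt' one_pos]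
    nlinarith [hx.1, hx.2, hy.1, hy.2]
  rw [integral_one_sub_rpow_eq_mul r q x, integral_one_sub_rpow_eq_mul r q y,
    integral_one_sub_rpow_eq_mul r q (Real.sqrt (x * y)), mul_mul_mul_comm,
    Real.sqrt_mul (mul_pos hx.1 hy.1).le]
  refine mul_lt_mul_of_pos_left ?_ hz.1
  have hX := integral_one_sub_mul_rpow_pos (r := r) hq hx
  have hY := integral_one_sub_mul_rpow_pos (r := r) hq hy
  have hcx := continuousOn_one_sub_mul_rpow (r := r) hq hx
  have hcy := continuousOn_one_sub_mul_rpow (r := r) hq hy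
  have hcz := continuousOn_one_sub_mul_rpow (r := r) hq hz
  have hix := hcx.intervalIntegrable_of_Icc (μ := volume) zero_le_one
  have hiy := hcy.intervalIntegrable_of_Icc (μ := volume) zero_le_one
  set X := ∫ s in (0:ℝ)..1, (1 - (x * s) ^ q) ^ r
  set Y := ∫ s in (0:ℝ)..1, (1 - (y * s) ^ q) ^ r
  have hW : 0 < Real.sqrt (X * Y) := Real.sqrt_pos.2 (mul_pos hX hY)
  have hWsq : Real.sqrt (X * Y) ^ 2 = X * Y := Real.sq_sqrt (mul_pos hX hY).le
  set W := Real.sqrt (X * Y)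
  have h_lt : ∀ s ∈ Set.Ioc (0 : ℝ) 1, 2 * W * (1 - (Real.sqrt (x * y) * s) ^ q) ^ r <
      Y * (1 - (x * s) ^ q) ^ r + X * (1 - (y * s) ^ q) ^ r := by
    intro s hs
    have hxs : x * s ∈ Set.Ioo (0 : ℝ) 1 :=
      ⟨mul_pos hx.1 hs.1, by nlinarith [hx.1, hx.2, hs.1, hs.2]⟩
    have hys : y * s ∈ Set.Ioo (0 : ℝ) 1 :=
      ⟨mul_pos hy.1 hs.1, by nlinarith [hy.1, hy.2, hs.1, hs.2]⟩
    have h := sq_one_sub_rpow_sqrt_mul_lt hr hq hxs hys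
      fun h => hxy (mul_right_cancel₀ hs.1.ne' h)
    rw [mul_mul_mul_comm, Real.sqrt_mul (mul_pos hx.1 hy.1).le, Real.sqrt_mul_self hs.1.le] at h
    have hfx : 0 < (1 - (x * s) ^ q) ^ r :=
      Real.rpow_pos_of_pos (sub_pos.2 (Real.rpow_lt_one hxs.1.le hxs.2 hq)) _
    have hfy : 0 < (1 - (y * s) ^ q) ^ r :=
      Real.rpow_pos_of_pos (sub_pos.2 (Real.rpow_lt_one hys.1.le hys.2 hq)) _
    refine lt_of_pow_lt_pow_left₀ 2 (by positivity) ?_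
    generalize (1 - (x * s) ^ q) ^ r = u at *
    generalize (1 - (y * s) ^ q) ^ r = v at *
    generalize (1 - (Real.sqrt (x * y) * s) ^ q) ^ r = w at *
    calc (2 * W * w) ^ 2 = 4 * (X * Y) * w ^ 2 := by rw [← hWsq]; ring
      _ < 4 * (X * Y) * (u * v) := mul_lt_mul_of_pos_left h (by positivity)
      _ ≤ (Y * u + X * v) ^ 2 := by nlinarith [sq_nonneg (Y * u - X * v)]
  have h_int := intervalIntegral.integral_lt_integral_of_continuousOn_of_le_of_exists_lt
    one_pos (hcz.const_mul (2 * W)) ((hcx.const_mul Y).add (hcy.const_mul X))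
    (fun s hs => (h_lt s hs).le) ⟨1, right_mem_Icc.2 zero_le_one, h_lt 1 ⟨one_pos, le_rfl⟩⟩
  simp only [Pi.add_apply] at h_int
  rw [intervalIntegral.integral_const_mul,
    intervalIntegral.integral_add (hix.const_mul Y) (hiy.const_mul X),
    intervalIntegral.integral_const_mul, intervalIntegral.integral_const_mul] at h_int
  refine lt_of_mul_lt_mul_left (a := 2 * W) ?_ (by positivity)
  calc _ < Y * X + X * Y := h_int
    _ = 2 * W * W := by linear_combination -2 * hWsq

/-- Equality case in (2.14) with `p₁ = 0`: for `p, q ∈ (1, ∞)` and `x, y ∈ (0,1)`,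
equality `arcsin_{p,q}(√(xy)) = √(arcsin_{p,q}(x) · arcsin_{p,q}(y))` holds iff
`x = y`; in particular, if `x ≠ y` the inequality is strict. -/
theorem arcsin_pq_geom_mean_eq_iff (p q : ℝ) (hp : 1 < p) (hq : 1 < q)
    (x y : ℝ) (hx : x ∈ Set.Ioo (0 : ℝ) 1) (hy : y ∈ Set.Ioo (0 : ℝ) 1) :
    ((∫ t in (0:ℝ)..Real.sqrt (x * y), (1 - t ^ q) ^ (-(1 / p))) =
        Real.sqrt ((∫ t in (0:ℝ)..x, (1 - t ^ q) ^ (-(1 / p))) *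
          (∫ t in (0:ℝ)..y, (1 - t ^ q) ^ (-(1 / p)))) ↔ x = y) ∧
      (x ≠ y →
        (∫ t in (0:ℝ)..Real.sqrt (x * y), (1 - t ^ q) ^ (-(1 / p))) <
          Real.sqrt ((∫ t in (0:ℝ)..x, (1 - t ^ q) ^ (-(1 / p))) *
            (∫ t in (0:ℝ)..y, (1 - t ^ q) ^ (-(1 / p))))) := by
  have h_strict := integral_one_sub_rpow_sqrt_mul_lt (r := -(1 / p)) (q := q)
    (neg_lt_zero.2 (by positivity)) (by positivity) hx hy
  refine ⟨⟨fun h => by_contra fun hxy => (h_strict hxy).ne h, ?_⟩, h_strict⟩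
  rintro rfl
  have hF : 0 ≤ ∫ t in (0:ℝ)..x, (1 - t ^ q) ^ (-(1 / p)) := by
    rw [integral_one_sub_rpow_eq_mul]
    exact (mul_pos hx.1 (integral_one_sub_mul_rpow_pos (by positivity) hx)).le
  rw [Real.sqrt_mul_self hx.1.le, Real.sqrt_mul_self hF]
end

section
/- Let p, q ∈ (1, ∞) and let p₁ < 0. For all x, y ∈ (0, 1), one has arcsin_{p,q}(H_{p₁}(x, y)) ≤ √(arcsin_{p,q}(x) · arcsin_{p,q}(y)), where H_{p₁}(x, y) = ((x^{p₁} + y^{p₁})/2)^{1/p₁}. -/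
open MeasureTheory Set

/-- A Hölder mean of negative order is at most the geometric mean. -/
theorem holder_mean_le_sqrt_mul {r x y : ℝ} (hr : r < 0) (hx : 0 < x) (hy : 0 < y) :
    ((x ^ r + y ^ r) / 2) ^ (1 / r) ≤ √(x * y) := by
  have hm : 0 < √(x * y) := Real.sqrt_pos.2 (mul_pos hx hy)
  have hsq : (√(x * y) ^ r) ^ 2 = x ^ r * y ^ r := by
    rw [← Real.mul_rpow hx.le hy.le, ← Real.rpow_mul_natCast hm.le, mul_comm r,
      Real.rpow_mul hm.le, Real.rpow_natCast, Real.sq_sqrt (mul_pos hx hy).le]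
  have hle : √(x * y) ^ r ≤ (x ^ r + y ^ r) / 2 := by
    have := Real.rpow_pos_of_pos hx r
    have := Real.rpow_pos_of_pos hy r
    refine le_of_sq_le_sq ?_ (by positivity)
    nlinarith [sq_nonneg (x ^ r - y ^ r)]
  calc ((x ^ r + y ^ r) / 2) ^ (1 / r) ≤ (√(x * y) ^ r) ^ (1 / r) :=
        Real.rpow_le_rpow_of_nonpos (Real.rpow_pos_of_pos hm r) hle
          (one_div_neg.2 hr).le
    _ = √(x * y) := by
        rw [← Real.rpow_mul hm.le, mul_one_div_cancel hr.ne, Real.rpow_one]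

theorem one_sub_rpow_pos {q t : ℝ} (hq : 0 < q) (ht : 0 ≤ t) (ht1 : t < 1) :
    0 < 1 - t ^ q :=
  sub_pos.2 (Real.rpow_lt_one ht ht1 hq)

theorem intervalIntegrable_one_sub_rpow {q x : ℝ} (r : ℝ) (hq : 0 < q) (hx : 0 ≤ x)
    (hx1 : x < 1) :
    IntervalIntegrable (fun t : ℝ => (1 - t ^ q) ^ r) volume 0 x := by
  refine ContinuousOn.intervalIntegrable ?_
  rw [uIcc_of_le hx]
  intro t ht
  refine ContinuousAt.continuousWithinAt ?_
  exact ((Real.continuousAt_rpow_const t q (Or.inr hq.le)).const_sub 1).rpow_const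
    (Or.inl (one_sub_rpow_pos hq ht.1 (ht.2.trans_lt hx1)).ne')

theorem integral_one_sub_rpow_pos {q x : ℝ} (r : ℝ) (hq : 0 < q) (hx : 0 < x) (hx1 : x < 1) :
    0 < ∫ t in (0 : ℝ)..x, (1 - t ^ q) ^ r :=
  intervalIntegral.intervalIntegral_pos_of_pos_on
    (intervalIntegrable_one_sub_rpow r hq hx.le hx1)
    (fun _ ht => Real.rpow_pos_of_pos (one_sub_rpow_pos hq ht.1.le (ht.2.trans hx1)) r) hx

/-- The integrand `t ↦ (1 - t ^ q) ^ r`, `r ≤ 0`, is geometrically midpoint convex. -/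
theorem one_sub_rpow_sqrt_mul_sq_le {q r a b : ℝ} (hq : 0 < q) (hr : r ≤ 0)
    (ha : 0 ≤ a) (ha1 : a < 1) (hb : 0 ≤ b) (hb1 : b < 1) :
    ((1 - √(a * b) ^ q) ^ r) ^ 2 ≤ (1 - a ^ q) ^ r * (1 - b ^ q) ^ r := by
  have hA := one_sub_rpow_pos hq ha ha1
  have hB := one_sub_rpow_pos hq hb hb1
  have hm : 0 ≤ √(a * b) := Real.sqrt_nonneg _
  have hm1 : √(a * b) < 1 := by
    rw [Real.sqrt_lt' one_pos]
    nlinarith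
  have hM := one_sub_rpow_pos hq hm hm1
  have hsq : (√(a * b) ^ q) ^ 2 = a ^ q * b ^ q := by
    rw [← Real.mul_rpow ha hb, ← Real.rpow_mul_natCast hm, mul_comm q,
      Real.rpow_mul hm, Real.rpow_natCast, Real.sq_sqrt (mul_nonneg ha hb)]
  have hle : √(a * b) ^ q ≤ (a ^ q + b ^ q) / 2 := by
    have := Real.rpow_nonneg ha q
    have := Real.rpow_nonneg hb q
    refine le_of_sq_le_sq ?_ (by positivity)
    nlinarith [sq_nonneg (a ^ q - b ^ q)]
  calc ((1 - √(a * b) ^ q) ^ r) ^ 2 = ((1 - √(a * b) ^ q) ^ 2) ^ r := by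
        rw [← Real.rpow_mul_natCast hM.le, mul_comm r, Real.rpow_mul hM.le, Real.rpow_natCast]
    _ ≤ ((1 - a ^ q) * (1 - b ^ q)) ^ r :=
        Real.rpow_le_rpow_of_nonpos (mul_pos hA hB) (by nlinarith) hr
    _ = _ := Real.mul_rpow hA.le hB.le

/-- Geometric midpoint convexity passes to the integral, by rescaling to `[0, 1]` and
applying the Cauchy–Schwarz inequality. -/
theorem integral_one_sub_rpow_sqrt_mul_le {q r x y : ℝ} (hq : 0 < q) (hr : r ≤ 0)
    (hx : x ∈ Ioo (0 : ℝ) 1) (hy : y ∈ Ioo (0 : ℝ) 1) :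
    (∫ t in (0 : ℝ)..√(x * y), (1 - t ^ q) ^ r) ≤
      √((∫ t in (0 : ℝ)..x, (1 - t ^ q) ^ r) * ∫ t in (0 : ℝ)..y, (1 - t ^ q) ^ r) := by
  obtain ⟨hx0, hx1⟩ := hx
  obtain ⟨hy0, hy1⟩ := hy
  have hm0 : 0 < √(x * y) := Real.sqrt_pos.2 (mul_pos hx0 hy0)
  have hm1 : √(x * y) < 1 := by
    rw [Real.sqrt_lt' one_pos]
    nlinarith
  have hscale (z : ℝ) : (∫ t in (0 : ℝ)..z, (1 - t ^ q) ^ r) =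
      ∫ s in (0 : ℝ)..1, z * (1 - (z * s) ^ q) ^ r := by
    have := intervalIntegral.mul_integral_comp_mul_left (a := 0) (b := 1)
      (f := fun t : ℝ => (1 - t ^ q) ^ r) (c := z)
    rw [intervalIntegral.integral_const_mul, this, mul_zero, mul_one]
  have hint {z : ℝ} (hz : 0 < z) (hz1 : z < 1) :
      IntervalIntegrable (fun s : ℝ => z * (1 - (z * s) ^ q) ^ r) volume 0 1 := by
    have := (intervalIntegrable_one_sub_rpow r hq hz.le hz1).comp_mul_left (c := z)
    rw [zero_div, div_self hz.ne'] at this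
    exact this.const_mul z
  have hA := integral_one_sub_rpow_pos r hq hx0 hx1
  have hB := integral_one_sub_rpow_pos r hq hy0 hy1
  set A := ∫ t in (0 : ℝ)..x, (1 - t ^ q) ^ r
  set B := ∫ t in (0 : ℝ)..y, (1 - t ^ q) ^ r
  have hSA := Real.sqrt_pos.2 hA
  have hSB := Real.sqrt_pos.2 hB
  have hpoint : ∀ s ∈ Icc (0 : ℝ) 1, √(x * y) * (1 - (√(x * y) * s) ^ q) ^ r ≤
      √B / √A / 2 * (x * (1 - (x * s) ^ q) ^ r) +
        √A / √B / 2 * (y * (1 - (y * s) ^ q) ^ r) := by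
    rintro s ⟨hs0, hs1⟩
    have hxs : x * s < 1 := by nlinarith
    have hys : y * s < 1 := by nlinarith
    have hxs0 := mul_nonneg hx0.le hs0
    have hys0 := mul_nonneg hy0.le hs0
    have hsqrt : √(x * s * (y * s)) = √(x * y) * s := by
      rw [mul_mul_mul_comm, Real.sqrt_mul (mul_pos hx0 hy0).le, Real.sqrt_mul_self hs0]
    have h := one_sub_rpow_sqrt_mul_sq_le hq hr hxs0 hxs hys0 hys
    rw [hsqrt] at h
    have hU := Real.rpow_pos_of_pos (one_sub_rpow_pos hq hxs0 hxs) r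
    have hV := Real.rpow_pos_of_pos (one_sub_rpow_pos hq hys0 hys) r
    set U := (1 - (x * s) ^ q) ^ r
    set V := (1 - (y * s) ^ q) ^ r
    refine le_of_sq_le_sq ?_ (by positivity)
    have hprod : √B / √A / 2 * (x * U) * (√A / √B / 2 * (y * V)) = x * y * (U * V) / 4 := by
      field_simp
      norm_num
    have hsq : (√(x * y) * (1 - (√(x * y) * s) ^ q) ^ r) ^ 2 ≤ x * y * (U * V) := by
      rw [mul_pow, Real.sq_sqrt (mul_pos hx0 hy0).le]
      exact mul_le_mul_of_nonneg_left h (mul_pos hx0 hy0).le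
    nlinarith [sq_nonneg (√B / √A / 2 * (x * U) - √A / √B / 2 * (y * V))]
  calc (∫ t in (0 : ℝ)..√(x * y), (1 - t ^ q) ^ r)
      = ∫ s in (0 : ℝ)..1, √(x * y) * (1 - (√(x * y) * s) ^ q) ^ r := hscale _
    _ ≤ ∫ s in (0 : ℝ)..1, (√B / √A / 2 * (x * (1 - (x * s) ^ q) ^ r) +
        √A / √B / 2 * (y * (1 - (y * s) ^ q) ^ r)) :=
        intervalIntegral.integral_mono_on zero_le_one (hint hm0 hm1)
          (((hint hx0 hx1).const_mul _).add ((hint hy0 hy1).const_mul _)) hpoint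
    _ = √B / √A / 2 * A + √A / √B / 2 * B := by
        rw [intervalIntegral.integral_add ((hint hx0 hx1).const_mul _)
          ((hint hy0 hy1).const_mul _), intervalIntegral.integral_const_mul (√B / √A / 2),
          intervalIntegral.integral_const_mul (√A / √B / 2), ← hscale, ← hscale]
    _ = √(A * B) := by
        rw [Real.sqrt_mul hA.le]
        have h1 := Real.mul_self_sqrt hA.le
        have h2 := Real.mul_self_sqrt hB.le
        generalize √A = a at *
        generalize √B = b at *
        rw [← h1, ← h2]
        field_simp
        norm_num

/-- Inequality (2.14): for `p, q ∈ (1, ∞)`, `p₁ < 0` and `x, y ∈ (0, 1)`,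
`arcsin_{p,q}(H_{p₁}(x, y)) ≤ √(arcsin_{p,q}(x) · arcsin_{p,q}(y))`,
where `H_{p₁}(x, y) = ((x^{p₁} + y^{p₁})/2)^{1/p₁}` is the Hölder mean. -/
theorem arcsin_pq_holder_mean (p q : ℝ) (hp : 1 < p) (hq : 1 < q)
    (p₁ : ℝ) (hp₁ : p₁ < 0)
    (x y : ℝ) (hx : x ∈ Set.Ioo (0 : ℝ) 1) (hy : y ∈ Set.Ioo (0 : ℝ) 1) :
    (∫ t in (0:ℝ)..((x ^ p₁ + y ^ p₁) / 2) ^ (1 / p₁), (1 - t ^ q) ^ (-(1 / p))) ≤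
      Real.sqrt ((∫ t in (0:ℝ)..x, (1 - t ^ q) ^ (-(1 / p))) *
        (∫ t in (0:ℝ)..y, (1 - t ^ q) ^ (-(1 / p)))) := by
  have hq0 : 0 < q := one_pos.trans hq
  have hr : -(1 / p) ≤ 0 := neg_nonpos.2 (one_div_pos.2 (one_pos.trans hp)).le
  have hm1 : √(x * y) < 1 := by
    rw [Real.sqrt_lt' one_pos]
    nlinarith [hx.1, hx.2, hy.1, hy.2]
  have hH : 0 ≤ ((x ^ p₁ + y ^ p₁) / 2) ^ (1 / p₁) := by
    have := Real.rpow_pos_of_pos hx.1 p₁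
    have := Real.rpow_pos_of_pos hy.1 p₁
    positivity
  refine le_trans ?_ (integral_one_sub_rpow_sqrt_mul_le hq0 hr hx hy)
  refine intervalIntegral.integral_mono_interval le_rfl hH
    (holder_mean_le_sqrt_mul hp₁ hx.1 hy.1) ?_
    (intervalIntegrable_one_sub_rpow _ hq0 (Real.sqrt_nonneg _) hm1)
  filter_upwards [ae_restrict_mem measurableSet_Ioc] with t ht
  exact Real.rpow_nonneg (one_sub_rpow_pos hq0 ht.1.le (ht.2.trans_lt hm1)).le _
end

section
/- Let p, q ∈ (1, ∞). For all x, y ∈ (0, ∞), one has arcsinh_{p,q}(√(x·y)) ≥ √(arcsinh_{p,q}(x) · arcsinh_{p,q}(y)). -/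
open MeasureTheory Set

/-- The square root of the product is a point of log-concavity for the primitive of `f` in the
multiplicative variable, whenever `f` satisfies `f b * f (a * u) ≤ f a * f (b * u)` for `a ≤ b`. -/
theorem sqrt_integral_mul_integral_le {f : ℝ → ℝ} (hf : Continuous f) (hpos : ∀ t, 0 < f t)
    (hmul : ∀ a b u, 0 < a → a ≤ b → 0 ≤ u → u ≤ 1 → f b * f (a * u) ≤ f a * f (b * u))
    {x y : ℝ} (hx : 0 < x) (hy : 0 < y) :
    Real.sqrt ((∫ t in (0:ℝ)..x, f t) * ∫ t in (0:ℝ)..y, f t) ≤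
      ∫ t in (0:ℝ)..Real.sqrt (x * y), f t := by
  set F : ℝ → ℝ := fun z => ∫ t in (0:ℝ)..z, f t with hF
  have hFpos : ∀ z, 0 < z → 0 < F z := fun z hz =>
    intervalIntegral.intervalIntegral_pos_of_pos (hf.intervalIntegrable _ _) hpos hz
  have hscale : ∀ z, F z = z * ∫ u in (0:ℝ)..1, f (z * u) := fun z => by
    rw [intervalIntegral.mul_integral_comp_mul_left]; simp [hF]
  have hderiv : ∀ s, HasDerivAt (fun s => Real.log (F (Real.exp s)))
      (f (Real.exp s) * Real.exp s / F (Real.exp s)) s := fun s =>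
    ((hf.integral_hasStrictDerivAt 0 (Real.exp s)).hasDerivAt.comp s
      (Real.hasDerivAt_exp s)).log (hFpos _ (Real.exp_pos s)).ne'
  have hanti : Antitone (deriv fun s => Real.log (F (Real.exp s))) := by
    intro s t hst
    rw [(hderiv s).deriv, (hderiv t).deriv]
    have hst' := Real.exp_le_exp.mpr hst
    have ha := Real.exp_pos s
    have hb := Real.exp_pos t
    generalize Real.exp s = a at *
    generalize Real.exp t = b at *
    rw [div_le_div_iff₀ (hFpos b hb) (hFpos a ha), hscale a, hscale b]
    have key : f b * ∫ u in (0:ℝ)..1, f (a * u) ≤ f a * ∫ u in (0:ℝ)..1, f (b * u) := by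
      rw [← intervalIntegral.integral_const_mul, ← intervalIntegral.integral_const_mul]
      refine intervalIntegral.integral_mono_on zero_le_one
        (Continuous.intervalIntegrable (by fun_prop) _ _)
        (Continuous.intervalIntegrable (by fun_prop) _ _) fun u hu => ?_
      exact hmul a b u ha hst' hu.1 hu.2
    nlinarith [mul_le_mul_of_nonneg_left key (mul_pos ha hb).le]
  have hconc := hanti.concaveOn_univ_of_deriv fun s => (hderiv s).differentiableAt
  have hmid := hconc.2 (mem_univ (Real.log x)) (mem_univ (Real.log y))
    (by norm_num : (0:ℝ) ≤ 1 / 2) (by norm_num : (0:ℝ) ≤ 1 / 2) (by norm_num)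
  have hexp : Real.exp ((1 / 2 : ℝ) • Real.log x + (1 / 2 : ℝ) • Real.log y) =
      Real.sqrt (x * y) := by
    rw [← Real.exp_log (Real.sqrt_pos.mpr (mul_pos hx hy)), Real.log_sqrt (mul_pos hx hy).le,
      Real.log_mul hx.ne' hy.ne']
    simp only [smul_eq_mul]
    ring_nf
  have hFx := hFpos x hx
  have hFy := hFpos y hy
  simp only [hexp, Real.exp_log hx, Real.exp_log hy] at hmid
  simp only [smul_eq_mul] at hmid
  change Real.sqrt (F x * F y) ≤ F (Real.sqrt (x * y))
  rw [← Real.log_le_log_iff (Real.sqrt_pos.mpr (mul_pos hFx hFy))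
    (hFpos _ (Real.sqrt_pos.mpr (mul_pos hx hy))), Real.log_sqrt (mul_pos hFx hFy).le,
    Real.log_mul hFx.ne' hFy.ne']
  linarith

/-- Inequality (2.21) with `p₂ = 0`: for `p, q ∈ (1, ∞)` and `x, y ∈ (0, ∞)`,
`arcsinh_{p,q}(√(xy)) ≥ √(arcsinh_{p,q}(x) · arcsinh_{p,q}(y))`,
where `arcsinh_{p,q}(x) = ∫₀ˣ (1 + t^q)^(-1/p) dt`. -/
theorem arcsinh_pq_geom_mean (p q : ℝ) (hp : 1 < p) (hq : 1 < q)
    (x y : ℝ) (hx : 0 < x) (hy : 0 < y) :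
    (∫ t in (0:ℝ)..Real.sqrt (x * y), (1 + t ^ q) ^ (-(1 / p))) ≥
      Real.sqrt ((∫ t in (0:ℝ)..x, (1 + t ^ q) ^ (-(1 / p))) *
        (∫ t in (0:ℝ)..y, (1 + t ^ q) ^ (-(1 / p)))) := by
  have hq0 : 0 ≤ q := by linarith
  have hbase : ∀ t : ℝ, 0 < 1 + |t| ^ q := fun t => by positivity
  have habs : ∀ z : ℝ, 0 ≤ z → (∫ t in (0:ℝ)..z, (1 + t ^ q) ^ (-(1 / p))) =
      ∫ t in (0:ℝ)..z, (1 + |t| ^ q) ^ (-(1 / p)) := fun z hz =>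
    intervalIntegral.integral_congr fun t ht => by
      rw [uIcc_of_le hz] at ht
      simp only [abs_of_nonneg ht.1]
  rw [habs _ (Real.sqrt_nonneg _), habs x hx.le, habs y hy.le]
  refine sqrt_integral_mul_integral_le ?_ (fun t => Real.rpow_pos_of_pos (hbase t) _) ?_ hx hy
  · exact (continuous_const.add (continuous_abs.rpow_const fun _ => Or.inr hq0)).rpow_const
      fun t => Or.inl (hbase t).ne'
  · intro a b u ha hab hu hu1
    have hb := ha.trans_le hab
    rw [← Real.mul_rpow (hbase _).le (hbase _).le, ← Real.mul_rpow (hbase _).le (hbase _).le]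
    refine Real.rpow_le_rpow_of_nonpos (mul_pos (hbase _) (hbase _)) ?_
      (neg_nonpos.mpr (by positivity))
    rw [abs_of_pos ha, abs_of_pos hb, abs_of_nonneg (mul_nonneg ha.le hu),
      abs_of_nonneg (mul_nonneg hb.le hu), Real.mul_rpow ha.le hu, Real.mul_rpow hb.le hu]
    nlinarith [mul_nonneg (sub_nonneg.mpr (Real.rpow_le_rpow ha.le hab hq0))
      (sub_nonneg.mpr (Real.rpow_le_one hu hu1 hq0))]
end

section
/- Let p, q ∈ (1, ∞). For x, y ∈ (0, ∞), equality holds in arcsinh_{p,q}(√(x·y)) ≥ √(arcsinh_{p,q}(x) · arcsinh_{p,q}(y)) if and only if x = y; in particular, if x ≠ y then arcsinh_{p,q}(√(x·y)) > √(arcsinh_{p,q}(x) · arcsinh_{p,q}(y)). -/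
open MeasureTheory Set

theorem integral_mul_integral_lt_sq_of_ratio_strictAnti {f : ℝ → ℝ} (hf : Continuous f)
    (hpos : ∀ t, 0 < f t) {r : ℝ} (hr : 1 < r)
    (hratio : ∀ s t, 0 < s → s < t → f (r * t) * f s < f (r * s) * f t) {x : ℝ} (hx : 0 < x) :
    (∫ t in (0:ℝ)..x, f t) * (∫ t in (0:ℝ)..r * (r * x), f t) <
      (∫ t in (0:ℝ)..r * x, f t) ^ 2 := by
  have hr0 : r ≠ 0 := by positivity
  have hxm : x < r * x := by nlinarith
  have hint : ∀ a b, IntervalIntegrable f volume a b := fun a b => hf.intervalIntegrable a b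
  have hg : Continuous fun t => f (r * t) := by fun_prop
  have hgint : ∀ a b, IntervalIntegrable (fun t => f (r * t)) volume a b :=
    fun a b => hg.intervalIntegrable a b
  have hscale : ∀ z, (∫ t in (0:ℝ)..r * z, f t) = r * ∫ t in (0:ℝ)..z, f (r * t) := by
    intro z
    rw [intervalIntegral.integral_comp_mul_left f hr0, smul_eq_mul, mul_zero]
    field_simp
  have hB : 0 < ∫ t in (0:ℝ)..x, f t :=
    intervalIntegral.intervalIntegral_pos_of_pos (hint _ _) hpos hx
  have hB' : 0 < ∫ t in x..r * x, f t :=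
    intervalIntegral.intervalIntegral_pos_of_pos (hint _ _) hpos hxm
  have hleft : 0 < ∫ t in (0:ℝ)..x, (f x * f (r * t) - f (r * x) * f t) := by
    apply intervalIntegral.intervalIntegral_pos_of_pos_on _ _ hx
    · exact Continuous.intervalIntegrable (by fun_prop) _ _
    · intro t ht
      linarith [hratio t x ht.1 ht.2]
  have hright : 0 < ∫ t in x..r * x, (f (r * x) * f t - f x * f (r * t)) := by
    apply intervalIntegral.intervalIntegral_pos_of_pos_on _ _ hxm
    · exact Continuous.intervalIntegrable (by fun_prop) _ _
    · intro t ht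
      linarith [hratio x t hx ht.1]
  rw [intervalIntegral.integral_sub ((hgint _ _).const_mul _) ((hint _ _).const_mul _),
    intervalIntegral.integral_const_mul, intervalIntegral.integral_const_mul] at hleft
  rw [intervalIntegral.integral_sub ((hint _ _).const_mul _) ((hgint _ _).const_mul _),
    intervalIntegral.integral_const_mul, intervalIntegral.integral_const_mul] at hright
  have hsq : (∫ t in (0:ℝ)..r * x, f t) ^ 2 =
      (r * ∫ t in (0:ℝ)..x, f (r * t)) *
        ((∫ t in (0:ℝ)..x, f t) + ∫ t in x..r * x, f t) := by
    rw [intervalIntegral.integral_add_adjacent_intervals (hint _ _) (hint _ _), ← hscale x, sq]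
  rw [hsq, hscale (r * x),
    ← intervalIntegral.integral_add_adjacent_intervals (hgint 0 x) (hgint x (r * x))]
  set A := ∫ t in (0:ℝ)..x, f (r * t)
  set A' := ∫ t in x..r * x, f (r * t)
  set B := ∫ t in (0:ℝ)..x, f t
  set B' := ∫ t in x..r * x, f t
  have hkey : A' * B < A * B' := by
    have h1 := mul_pos hright hB
    have h2 := mul_pos hleft hB'
    have h3 : f x * (A' * B) < f x * (A * B') := by linarith
    exact lt_of_mul_lt_mul_left h3 (hpos x).le
  have hmul := mul_lt_mul_of_pos_left hkey (show 0 < r by linarith)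
  linarith

theorem arcsinh_kernel_ratio_lt {p q r s t : ℝ} (hp : 0 < p) (hq : 0 < q) (hr : 1 < r)
    (hs : 0 < s) (hst : s < t) :
    (1 + |r * t| ^ q) ^ (-(1 / p)) * (1 + |s| ^ q) ^ (-(1 / p)) <
      (1 + |r * s| ^ q) ^ (-(1 / p)) * (1 + |t| ^ q) ^ (-(1 / p)) := by
  have hr0 : 0 < r := by linarith
  have ht : 0 < t := hs.trans hst
  rw [← Real.mul_rpow (by positivity) (by positivity),
    ← Real.mul_rpow (by positivity) (by positivity)]
  apply Real.rpow_lt_rpow_of_neg (by positivity)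
  · rw [abs_of_pos hs, abs_of_pos ht, abs_of_pos (by positivity), abs_of_pos (by positivity),
      Real.mul_rpow hr0.le hs.le, Real.mul_rpow hr0.le ht.le]
    have hR : 1 < r ^ q := Real.one_lt_rpow hr hq
    have hST : s ^ q < t ^ q := Real.rpow_lt_rpow hs.le hst hq
    nlinarith [mul_pos (sub_pos.2 hR) (sub_pos.2 hST)]
  · exact neg_neg_of_pos (by positivity)

theorem continuous_arcsinh_kernel_abs (p : ℝ) {q : ℝ} (hq : 0 ≤ q) :
    Continuous fun t : ℝ => (1 + |t| ^ q) ^ (-(1 / p)) :=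
  (continuous_const.add (continuous_abs.rpow_const fun _ => Or.inr hq)).rpow_const
    fun t => Or.inl (show 1 + |t| ^ q ≠ 0 by positivity)

theorem integral_arcsinh_kernel_abs (p q : ℝ) {x : ℝ} (hx : 0 ≤ x) :
    (∫ t in (0:ℝ)..x, (1 + |t| ^ q) ^ (-(1 / p))) =
      ∫ t in (0:ℝ)..x, (1 + t ^ q) ^ (-(1 / p)) := by
  refine intervalIntegral.integral_congr fun t ht => ?_
  rw [uIcc_of_le hx] at ht
  simp only [abs_of_nonneg ht.1]

theorem sqrt_mul_arcsinh_pq_lt_of_lt {p q x y : ℝ} (hp : 0 < p) (hq : 0 < q)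
    (hx : 0 < x) (hxy : x < y) :
    Real.sqrt ((∫ t in (0:ℝ)..x, (1 + t ^ q) ^ (-(1 / p))) *
        (∫ t in (0:ℝ)..y, (1 + t ^ q) ^ (-(1 / p)))) <
      ∫ t in (0:ℝ)..Real.sqrt (x * y), (1 + t ^ q) ^ (-(1 / p)) := by
  have hy : 0 < y := hx.trans hxy
  have hm : 0 < Real.sqrt (x * y) := Real.sqrt_pos.2 (mul_pos hx hy)
  have hmm : Real.sqrt (x * y) * Real.sqrt (x * y) = x * y :=
    Real.mul_self_sqrt (mul_pos hx hy).le
  have hxm : x < Real.sqrt (x * y) := Real.lt_sqrt_of_sq_lt (by nlinarith)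
  have hpos : ∀ t : ℝ, 0 < (1 + |t| ^ q) ^ (-(1 / p)) := fun t => by positivity
  have hcont := continuous_arcsinh_kernel_abs p hq.le
  have hr : 1 < Real.sqrt (x * y) / x := (one_lt_div hx).2 hxm
  have h := integral_mul_integral_lt_sq_of_ratio_strictAnti hcont hpos hr
    (fun s t hs hst => arcsinh_kernel_ratio_lt hp hq hr hs hst) hx
  have hrx : Real.sqrt (x * y) / x * x = Real.sqrt (x * y) := div_mul_cancel₀ _ hx.ne'
  have hrm : Real.sqrt (x * y) / x * Real.sqrt (x * y) = y := by
    rw [div_mul_eq_mul_div, hmm, mul_div_cancel_left₀ _ hx.ne']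
  rw [hrx, hrm] at h
  rw [← integral_arcsinh_kernel_abs p q hx.le, ← integral_arcsinh_kernel_abs p q hy.le,
    ← integral_arcsinh_kernel_abs p q hm.le]
  exact (Real.sqrt_lt' (intervalIntegral.intervalIntegral_pos_of_pos
    (hcont.intervalIntegrable _ _) hpos hm)).2 h

/-- Equality case in (2.21) with `p₂ = 0`: for `p, q ∈ (1, ∞)` and `x, y ∈ (0, ∞)`,
equality `arcsinh_{p,q}(√(xy)) = √(arcsinh_{p,q}(x) · arcsinh_{p,q}(y))` holds iff
`x = y`; in particular, if `x ≠ y` the inequality is strict. -/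
theorem arcsinh_pq_geom_mean_eq_iff (p q : ℝ) (hp : 1 < p) (hq : 1 < q)
    (x y : ℝ) (hx : 0 < x) (hy : 0 < y) :
    ((∫ t in (0:ℝ)..Real.sqrt (x * y), (1 + t ^ q) ^ (-(1 / p))) =
        Real.sqrt ((∫ t in (0:ℝ)..x, (1 + t ^ q) ^ (-(1 / p))) *
          (∫ t in (0:ℝ)..y, (1 + t ^ q) ^ (-(1 / p)))) ↔ x = y) ∧
      (x ≠ y →
        (∫ t in (0:ℝ)..Real.sqrt (x * y), (1 + t ^ q) ^ (-(1 / p))) >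
          Real.sqrt ((∫ t in (0:ℝ)..x, (1 + t ^ q) ^ (-(1 / p))) *
            (∫ t in (0:ℝ)..y, (1 + t ^ q) ^ (-(1 / p))))) := by
  have hstrict : x ≠ y →
      Real.sqrt ((∫ t in (0:ℝ)..x, (1 + t ^ q) ^ (-(1 / p))) *
          (∫ t in (0:ℝ)..y, (1 + t ^ q) ^ (-(1 / p)))) <
        ∫ t in (0:ℝ)..Real.sqrt (x * y), (1 + t ^ q) ^ (-(1 / p)) := by
    intro hne
    rcases hne.lt_or_gt with h | h
    · exact sqrt_mul_arcsinh_pq_lt_of_lt (by linarith) (by linarith) hx h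
    · have hlt := sqrt_mul_arcsinh_pq_lt_of_lt (p := p) (q := q) (by linarith) (by linarith) hy h
      rwa [mul_comm y x, mul_comm (∫ t in (0:ℝ)..y, _)] at hlt
  refine ⟨⟨fun heq => ?_, ?_⟩, hstrict⟩
  · by_contra hne
    exact (hstrict hne).ne' heq
  · rintro rfl
    have hnonneg : 0 ≤ ∫ t in (0:ℝ)..x, (1 + t ^ q) ^ (-(1 / p)) :=
      intervalIntegral.integral_nonneg hx.le fun t ht =>
        Real.rpow_nonneg (add_nonneg zero_le_one (Real.rpow_nonneg ht.1 q)) _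
    rw [Real.sqrt_mul_self hx.le, Real.sqrt_mul_self hnonneg]
end

section
/- Let p, q ∈ (1, ∞) and let p₁ > 0. Then the function F(x) = x^{1 - p₁} / (arcsin_{p,q}(x) · (1 - x^q)^{1/p}) is not monotone on (0, 1): it is neither monotone increasing nor monotone decreasing on (0, 1). -/
open MeasureTheory Set Filter Topology

/-- The integrand of `arcsin_{p,q}` is integrable on `[0, x]` for `x < 1`. -/
lemma intervalIntegrable_one_sub_rpow_rpow {q : ℝ} (hq : 0 < q) (s : ℝ) {x : ℝ}
    (hx0 : 0 ≤ x) (hx1 : x < 1) :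
    IntervalIntegrable (fun t : ℝ => (1 - t ^ q) ^ s) volume 0 x := by
  apply ContinuousOn.intervalIntegrable
  rw [uIcc_of_le hx0]
  refine ContinuousOn.rpow_const ?_ fun t ht => Or.inl ?_
  · exact continuousOn_const.sub (Real.continuous_rpow_const hq.le).continuousOn
  · exact (sub_pos.2 (Real.rpow_lt_one ht.1 (ht.2.trans_lt hx1) hq)).ne'

/-- `arcsin_{p,q}` is positive on `(0, 1)`. -/
lemma integral_one_sub_rpow_rpow_pos {q : ℝ} (hq : 0 < q) (s : ℝ) {x : ℝ}
    (hx0 : 0 < x) (hx1 : x < 1) : 0 < ∫ t in (0:ℝ)..x, (1 - t ^ q) ^ s :=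
  intervalIntegral.intervalIntegral_pos_of_pos_on
    (intervalIntegrable_one_sub_rpow_rpow hq s hx0.le hx1)
    (fun _ ht => Real.rpow_pos_of_pos
      (sub_pos.2 (Real.rpow_lt_one ht.1.le (ht.2.trans hx1) hq)) _) hx0

/-- `arcsin_{p,q}` is bounded by a linear function near the origin. -/
lemma integral_one_sub_rpow_rpow_le_mul {q s : ℝ} (hq : 0 < q) (hs : s ≤ 0) {x b : ℝ}
    (hx0 : 0 ≤ x) (hxb : x ≤ b) (hb : b < 1) :
    ∫ t in (0:ℝ)..x, (1 - t ^ q) ^ s ≤ (1 - b ^ q) ^ s * x := by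
  have h := intervalIntegral.integral_mono_on hx0
    (intervalIntegrable_one_sub_rpow_rpow hq s hx0 (hxb.trans_lt hb))
    (intervalIntegrable_const (c := (1 - b ^ q) ^ s)) fun t ht =>
      Real.rpow_le_rpow_of_nonpos
        (sub_pos.2 (Real.rpow_lt_one (hx0.trans hxb) hb hq))
        (sub_le_sub_left (Real.rpow_le_rpow ht.1 (ht.2.trans hxb) hq.le) 1) hs
  simpa [mul_comm] using h

/-- `arcsin_{p,q}` is bounded on `[0, 1)`. -/
lemma integral_one_sub_rpow_rpow_le {q s : ℝ} (hq : 1 ≤ q) (hs : s ≤ 0) (hs1 : -1 < s) {x : ℝ}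
    (hx0 : 0 ≤ x) (hx1 : x < 1) :
    ∫ t in (0:ℝ)..x, (1 - t ^ q) ^ s ≤ ∫ t in (0:ℝ)..1, (1 - t) ^ s := by
  have hint : IntervalIntegrable (fun t : ℝ => (1 - t) ^ s) volume 0 1 := by
    simpa using ((intervalIntegral.intervalIntegrable_rpow' (a := 0) (b := 1) hs1).comp_sub_left
      1).symm
  have hint' : IntervalIntegrable (fun t : ℝ => (1 - t) ^ s) volume 0 x :=
    hint.mono_set (by
      rw [uIcc_of_le hx0, uIcc_of_le zero_le_one]
      exact Icc_subset_Icc_right hx1.le)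
  calc ∫ t in (0:ℝ)..x, (1 - t ^ q) ^ s ≤ ∫ t in (0:ℝ)..x, (1 - t) ^ s := by
        refine intervalIntegral.integral_mono_on hx0
          (intervalIntegrable_one_sub_rpow_rpow (by linarith) s hx0 hx1) hint' fun t ht => ?_
        have ht1 : t < 1 := ht.2.trans_lt hx1
        exact Real.rpow_le_rpow_of_nonpos (sub_pos.2 ht1)
          (sub_le_sub_left (Real.rpow_le_self_of_le_one ht.1 ht1.le hq) 1) hs
    _ ≤ ∫ t in (0:ℝ)..1, (1 - t) ^ s := by
        refine intervalIntegral.integral_mono_interval le_rfl hx0 hx1.le ?_ hint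
        refine (ae_restrict_iff' measurableSet_Ioc).2 (Eventually.of_forall fun t ht => ?_)
        exact Real.rpow_nonneg (sub_nonneg.2 ht.2) _

/-- For `p, q ∈ (1, ∞)` and `p₁ > 0`, the function
`F(x) = x^(1-p₁) / (arcsin_{p,q}(x) · (1 - x^q)^(1/p))` is not monotone on
`(0, 1)`: it is neither monotone increasing nor monotone decreasing there. -/
theorem F_not_monotone (p q : ℝ) (hp : 1 < p) (hq : 1 < q) (p₁ : ℝ) (hp₁ : 0 < p₁) :
    ¬ MonotoneOn
        (fun x : ℝ => x ^ (1 - p₁) /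
          ((∫ t in (0:ℝ)..x, (1 - t ^ q) ^ (-(1 / p))) * (1 - x ^ q) ^ (1 / p)))
        (Set.Ioo (0 : ℝ) 1) ∧
      ¬ AntitoneOn
          (fun x : ℝ => x ^ (1 - p₁) /
            ((∫ t in (0:ℝ)..x, (1 - t ^ q) ^ (-(1 / p))) * (1 - x ^ q) ^ (1 / p)))
          (Set.Ioo (0 : ℝ) 1) := by
  have hq0 : 0 < q := by linarith
  have hp0 : 0 < 1 / p := by positivity
  have hp1 : 1 / p < 1 := (div_lt_one (by linarith)).2 hp
  have half_mem : (1 / 2 : ℝ) ∈ Ioo (0 : ℝ) 1 := by norm_num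
  have one_sub_pos {x : ℝ} (hx : x ∈ Ioo (0 : ℝ) 1) : 0 < 1 - x ^ q :=
    sub_pos.2 (Real.rpow_lt_one hx.1.le hx.2 hq0)
  have arcsin_pos {x : ℝ} (hx : x ∈ Ioo (0 : ℝ) 1) :=
    integral_one_sub_rpow_rpow_pos hq0 (-(1 / p)) hx.1 hx.2
  set F : ℝ → ℝ := fun x : ℝ => x ^ (1 - p₁) /
    ((∫ t in (0:ℝ)..x, (1 - t ^ q) ^ (-(1 / p))) * (1 - x ^ q) ^ (1 / p)) with hF
  have F_pos : 0 < F (1 / 2) :=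
    div_pos (Real.rpow_pos_of_pos half_mem.1 _)
      (mul_pos (arcsin_pos half_mem) (Real.rpow_pos_of_pos (one_sub_pos half_mem) _))
  have le_of_F_le {x : ℝ} (hx : x ∈ Ioo (0 : ℝ) 1) (h : F x ≤ F (1 / 2)) :
      x ^ (1 - p₁) ≤
        F (1 / 2) * ((∫ t in (0:ℝ)..x, (1 - t ^ q) ^ (-(1 / p))) * (1 - x ^ q) ^ (1 / p)) :=
    (div_le_iff₀ (mul_pos (arcsin_pos hx) (Real.rpow_pos_of_pos (one_sub_pos hx) _))).1 h
  constructor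
  · intro hmono
    set C : ℝ := (1 - (1 / 2 : ℝ) ^ q) ^ (-(1 / p))
    have bound : ∀ᶠ x in 𝓝[>] (0 : ℝ), 1 ≤ F (1 / 2) * C * x ^ p₁ := by
      filter_upwards [Ioo_mem_nhdsGT half_mem.1] with x hx
      have hx' : x ∈ Ioo (0 : ℝ) 1 := ⟨hx.1, hx.2.trans half_mem.2⟩
      have h := le_of_F_le hx' (hmono hx' half_mem hx.2.le)
      have hA := integral_one_sub_rpow_rpow_le_mul hq0 (neg_nonpos.2 hp0.le) hx.1.le hx.2.le
        half_mem.2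
      have hB : (1 - x ^ q) ^ (1 / p) ≤ 1 :=
        Real.rpow_le_one (one_sub_pos hx').le
          (sub_le_self _ (Real.rpow_nonneg hx.1.le _)) hp0.le
      have hAB := (mul_le_of_le_one_right (arcsin_pos hx').le hB).trans hA
      have h' := h.trans (mul_le_mul_of_nonneg_left hAB F_pos.le)
      have hpow : x ^ (1 - p₁) * x ^ p₁ = x := by
        rw [← Real.rpow_add hx.1, sub_add_cancel, Real.rpow_one]
      have h'' := mul_le_mul_of_nonneg_right h' (Real.rpow_nonneg hx.1.le p₁)
      rw [hpow] at h''
      refine le_of_mul_le_mul_right ?_ hx.1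
      calc 1 * x = x := one_mul x
        _ ≤ _ := h''
        _ = F (1 / 2) * C * x ^ p₁ * x := by ring
    have lim : Tendsto (fun x : ℝ => F (1 / 2) * C * x ^ p₁) (𝓝[>] 0) (𝓝 0) := by
      have h := ((Real.continuous_rpow_const hp₁.le).const_mul (F (1 / 2) * C)).tendsto 0
      rw [Real.zero_rpow hp₁.ne', mul_zero] at h
      exact h.mono_left nhdsWithin_le_nhds
    exact absurd (ge_of_tendsto lim bound) (by norm_num)
  · intro hanti
    set M : ℝ := ∫ t in (0:ℝ)..1, (1 - t) ^ (-(1 / p))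
    have bound : ∀ᶠ x in 𝓝[<] (1 : ℝ),
        x ^ (1 - p₁) ≤ F (1 / 2) * (M * (1 - x ^ q) ^ (1 / p)) := by
      filter_upwards [Ioo_mem_nhdsLT half_mem.2] with x hx
      have hx' : x ∈ Ioo (0 : ℝ) 1 := ⟨half_mem.1.trans hx.1, hx.2⟩
      have hA := integral_one_sub_rpow_rpow_le hq.le (neg_nonpos.2 hp0.le) (neg_lt_neg hp1)
        hx'.1.le hx'.2
      exact (le_of_F_le hx' (hanti half_mem hx' hx.1.le)).trans
        (mul_le_mul_of_nonneg_left
          (mul_le_mul_of_nonneg_right hA (Real.rpow_nonneg (one_sub_pos hx').le _)) F_pos.le)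
    have lim_left : Tendsto (fun x : ℝ => x ^ (1 - p₁)) (𝓝[<] 1) (𝓝 1) := by
      have h := (Real.continuousAt_rpow_const 1 (1 - p₁) (Or.inl one_ne_zero)).tendsto
      rw [Real.one_rpow] at h
      exact h.mono_left nhdsWithin_le_nhds
    have lim_right : Tendsto (fun x : ℝ => F (1 / 2) * (M * (1 - x ^ q) ^ (1 / p)))
        (𝓝[<] 1) (𝓝 0) := by
      have hc : Continuous fun x : ℝ => F (1 / 2) * (M * (1 - x ^ q) ^ (1 / p)) :=
        (((continuous_const.sub (Real.continuous_rpow_const hq0.le)).rpow_const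
          fun _ => Or.inr hp0.le).const_mul M).const_mul _
      have h := hc.tendsto 1
      rw [Real.one_rpow, sub_self, Real.zero_rpow hp0.ne', mul_zero, mul_zero] at h
      exact h.mono_left nhdsWithin_le_nhds
    exact absurd (le_of_tendsto_of_tendsto lim_left lim_right bound) (by norm_num)
end

section
/- Let p, q ∈ (1, ∞). Then G(x) = q·x^q / (p·(1 - x^q)) − x / (arcsin_{p,q}(x) · (1 - x^q)^{1/p}) satisfies lim_{x → 0⁺} G(x) = −1 and G(x) → +∞ as x → 1⁻. -/
open MeasureTheory Set Filter

/-- On `(0, 1)` the quotient `x / (arcsin_{p,q}(x) · (1 - x^q)^(1/p))` lies between `1` and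
`(1 - x^q)^(-1/p)`, since the integrand of `arcsin_{p,q}` is increasing. -/
theorem div_arcsin_mul_mem_Icc {p q x : ℝ} (hp : 0 < p) (hq : 0 < q) (hx : x ∈ Ioo (0 : ℝ) 1) :
    x / ((∫ t in (0:ℝ)..x, (1 - t ^ q) ^ (-(1 / p))) * (1 - x ^ q) ^ (1 / p)) ∈
      Icc 1 ((1 - x ^ q) ^ (-(1 / p))) := by
  obtain ⟨hx0, hx1⟩ := hx
  have hpow {t : ℝ} (ht : t ∈ Icc 0 x) : t ^ q ≤ x ^ q :=
    Real.rpow_le_rpow ht.1 ht.2 hq.le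
  have hxq : x ^ q < 1 := Real.rpow_lt_one hx0.le hx1 hq
  have hu : 0 < 1 - x ^ q := sub_pos.2 hxq
  have hexp : -(1 / p) ≤ 0 := neg_nonpos.2 (by positivity)
  have hint : IntervalIntegrable (fun t : ℝ => (1 - t ^ q) ^ (-(1 / p))) volume 0 x := by
    refine ContinuousOn.intervalIntegrable ?_
    rw [uIcc_of_le hx0.le]
    refine ContinuousOn.rpow_const ?_ fun t ht => Or.inl ?_
    · exact continuousOn_const.sub (continuousOn_id.rpow_const fun _ _ => Or.inr hq.le)
    · exact (by linarith [hpow ht] : 0 < 1 - t ^ q).ne'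
  have hlower : x ≤ ∫ t in (0:ℝ)..x, (1 - t ^ q) ^ (-(1 / p)) := by
    have h := intervalIntegral.integral_mono_on hx0.le
      (intervalIntegrable_const (c := (1 : ℝ))) hint fun t ht =>
        Real.one_le_rpow_of_pos_of_le_one_of_nonpos (by linarith [hpow ht])
          (by linarith [Real.rpow_nonneg ht.1 q]) hexp
    simpa using h
  have hupper : ∫ t in (0:ℝ)..x, (1 - t ^ q) ^ (-(1 / p)) ≤ x * (1 - x ^ q) ^ (-(1 / p)) := by
    have h := intervalIntegral.integral_mono_on hx0.le hint
      (intervalIntegrable_const (c := (1 - x ^ q) ^ (-(1 / p)))) fun t ht =>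
        Real.rpow_le_rpow_of_nonpos hu (by linarith [hpow ht]) hexp
    simpa using h
  generalize (∫ t in (0:ℝ)..x, (1 - t ^ q) ^ (-(1 / p))) = F at hlower hupper ⊢
  have hw : 0 < (1 - x ^ q) ^ (1 / p) := Real.rpow_pos_of_pos hu _
  rw [Real.rpow_neg hu.le] at hupper ⊢
  generalize (1 - x ^ q) ^ (1 / p) = w at hw hupper ⊢
  have hF : 0 < F := hx0.trans_le hlower
  constructor
  · rwa [one_le_div (by positivity), ← le_div_iff₀ hw, div_eq_mul_inv]
  · rw [div_le_iff₀ (by positivity)]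
    field_simp
    exact hlower

/-- The comparison function `c (1 - u) / u - u^(-s)` blows up as `u → 0⁺` when `s < 1`. -/
theorem tendsto_mul_one_sub_div_sub_rpow_neg_atTop {c s : ℝ} (hc : 0 < c) (hs : s < 1) :
    Tendsto (fun u : ℝ => c * (1 - u) / u - u ^ (-s)) (nhdsWithin 0 (Ioi 0)) atTop := by
  have hlim : Tendsto (fun u : ℝ => c * (1 - u) - u ^ (1 - s)) (nhdsWithin 0 (Ioi 0))
      (nhds c) := by
    have h : ContinuousAt (fun u : ℝ => c * (1 - u) - u ^ (1 - s)) 0 :=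
      (by fun_prop : ContinuousAt (fun u : ℝ => c * (1 - u)) 0).sub
        (Real.continuousAt_rpow_const _ _ (Or.inr (sub_pos.2 hs).le))
    have h' := h.tendsto.mono_left (nhdsWithin_le_nhds (s := Ioi 0))
    simpa [Real.zero_rpow (sub_pos.2 hs).ne'] using h'
  refine (hlim.pos_mul_atTop hc tendsto_inv_nhdsGT_zero).congr' ?_
  filter_upwards [self_mem_nhdsWithin] with u hu
  have hu : 0 < u := hu
  rw [sub_mul, ← div_eq_mul_inv, ← Real.rpow_neg_one u, ← Real.rpow_add hu]
  ring_nf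

/-- For `p, q ∈ (1, ∞)`, the function
`G(x) = q x^q / (p (1 - x^q)) − x / (arcsin_{p,q}(x) · (1 - x^q)^(1/p))`
tends to `-1` as `x → 0⁺` and to `+∞` as `x → 1⁻`. -/
theorem G_limits (p q : ℝ) (hp : 1 < p) (hq : 1 < q) :
    Filter.Tendsto
        (fun x : ℝ => q * x ^ q / (p * (1 - x ^ q)) -
          x / ((∫ t in (0:ℝ)..x, (1 - t ^ q) ^ (-(1 / p))) * (1 - x ^ q) ^ (1 / p)))
        (nhdsWithin 0 (Set.Ioi (0 : ℝ))) (nhds (-1)) ∧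
      Filter.Tendsto
        (fun x : ℝ => q * x ^ q / (p * (1 - x ^ q)) -
          x / ((∫ t in (0:ℝ)..x, (1 - t ^ q) ^ (-(1 / p))) * (1 - x ^ q) ^ (1 / p)))
        (nhdsWithin 1 (Set.Iio (1 : ℝ))) Filter.atTop := by
  have hp0 : 0 < p := by linarith
  have hq0 : 0 < q := by linarith
  have hcont (a : ℝ) : ContinuousAt (fun x : ℝ => x ^ q) a :=
    Real.continuousAt_rpow_const a q (Or.inr hq0.le)
  constructor
  · have hfirst : Tendsto (fun x : ℝ => q * x ^ q / (p * (1 - x ^ q)))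
        (nhdsWithin 0 (Ioi 0)) (nhds 0) := by
      have h : ContinuousAt (fun x : ℝ => q * x ^ q / (p * (1 - x ^ q))) 0 :=
        (continuousAt_const.mul (hcont 0)).div
          (continuousAt_const.mul (continuousAt_const.sub (hcont 0)))
          (by simp [Real.zero_rpow hq0.ne', hp0.ne'])
      simpa [Real.zero_rpow hq0.ne'] using
        h.tendsto.mono_left (nhdsWithin_le_nhds (s := Ioi 0))
    have hbound : Tendsto (fun x : ℝ => (1 - x ^ q) ^ (-(1 / p)))
        (nhdsWithin 0 (Ioi 0)) (nhds 1) := by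
      have h : ContinuousAt (fun x : ℝ => (1 - x ^ q) ^ (-(1 / p))) 0 :=
        (continuousAt_const.sub (hcont 0)).rpow_const
          (Or.inl (by simp [Real.zero_rpow hq0.ne']))
      simpa [Real.zero_rpow hq0.ne'] using
        h.tendsto.mono_left (nhdsWithin_le_nhds (s := Ioi 0))
    have hmem : ∀ᶠ x : ℝ in nhdsWithin 0 (Ioi 0), x ∈ Ioo (0 : ℝ) 1 :=
      Ioo_mem_nhdsGT one_pos
    have hsecond := tendsto_of_tendsto_of_tendsto_of_le_of_le' tendsto_const_nhds hbound
      (hmem.mono fun x hx => (div_arcsin_mul_mem_Icc hp0 hq0 hx).1)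
      (hmem.mono fun x hx => (div_arcsin_mul_mem_Icc hp0 hq0 hx).2)
    simpa using hfirst.sub hsecond
  · have hmem : ∀ᶠ x : ℝ in nhdsWithin 1 (Iio 1), x ∈ Ioo (0 : ℝ) 1 :=
      Ioo_mem_nhdsLT one_pos
    have hu : Tendsto (fun x : ℝ => 1 - x ^ q) (nhdsWithin 1 (Iio 1))
        (nhdsWithin 0 (Ioi 0)) := by
      refine tendsto_nhdsWithin_iff.2 ⟨?_, hmem.mono fun x hx =>
        sub_pos.2 (Real.rpow_lt_one hx.1.le hx.2 hq0)⟩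
      have h : ContinuousAt (fun x : ℝ => 1 - x ^ q) 1 := continuousAt_const.sub (hcont 1)
      simpa using h.tendsto.mono_left (nhdsWithin_le_nhds (s := Iio 1))
    refine tendsto_atTop_mono' _ ?_ ((tendsto_mul_one_sub_div_sub_rpow_neg_atTop
      (div_pos hq0 hp0) ((div_lt_one hp0).2 hp)).comp hu)
    filter_upwards [hmem] with x hx
    have hfirst : q / p * (1 - (1 - x ^ q)) / (1 - x ^ q) = q * x ^ q / (p * (1 - x ^ q)) := by
      rw [sub_sub_cancel, div_mul_eq_mul_div, div_div]
    rw [Function.comp_apply, hfirst]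
    exact sub_le_sub_left (div_arcsin_mul_mem_Icc hp0 hq0 hx).2 _
end

section
/- Let p, q ∈ (1, ∞) and let p₂ ≥ 0. Then the function F*(x) = x^{1 - p₂} / (arcsinh_{p,q}(x) · (1 + x^q)^{1/p}) is strictly decreasing on (0, ∞). -/
open MeasureTheory Set

/-- The substitution `t = x * s` in `arcsinh_{p,q}(x) * (1 + x ^ q) ^ (1 / p)`. -/
theorem arcsinh_mul_eq_mul_integral (p q x : ℝ) :
    (∫ t in (0:ℝ)..x, (1 + t ^ q) ^ (-(1 / p))) * (1 + x ^ q) ^ (1 / p) =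
      x * ∫ s in (0:ℝ)..1, (1 + x ^ q) ^ (1 / p) * (1 + (x * s) ^ q) ^ (-(1 / p)) := by
  have h := intervalIntegral.smul_integral_comp_mul_left (a := 0) (b := 1)
    (fun t : ℝ => (1 + t ^ q) ^ (-(1 / p))) x
  simp only [mul_zero, mul_one, smul_eq_mul] at h
  rw [intervalIntegral.integral_const_mul, ← h]
  ring

theorem continuousOn_rescaled_integrand (p : ℝ) {q x : ℝ} (hq : 0 < q) (hx : 0 < x) :
    ContinuousOn (fun s : ℝ => (1 + x ^ q) ^ (1 / p) * (1 + (x * s) ^ q) ^ (-(1 / p)))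
      (Icc 0 1) := by
  refine continuousOn_const.mul (ContinuousOn.rpow_const ?_ ?_)
  · exact continuousOn_const.add
      ((continuousOn_const.mul continuousOn_id).rpow_const fun _ _ => Or.inr hq.le)
  · intro s hs
    have := Real.rpow_nonneg (mul_nonneg hx.le hs.1) q
    exact Or.inl (by positivity)

theorem rescaled_integrand_eq_div_rpow (p : ℝ) {q x s : ℝ} (hx : 0 < x) (hs : 0 ≤ s) :
    (1 + x ^ q) ^ (1 / p) * (1 + (x * s) ^ q) ^ (-(1 / p)) =
      ((1 + x ^ q) / (1 + x ^ q * s ^ q)) ^ (1 / p) := by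
  rw [Real.mul_rpow hx.le hs, Real.rpow_neg (by positivity), Real.div_rpow (by positivity)
    (by positivity), ← div_eq_mul_inv]

theorem rescaled_integrand_le {p q x y s : ℝ} (hp : 0 < p) (hq : 0 < q) (hx : 0 < x)
    (hxy : x < y) (hs : 0 ≤ s) (hs1 : s ≤ 1) :
    (1 + x ^ q) ^ (1 / p) * (1 + (x * s) ^ q) ^ (-(1 / p)) ≤
      (1 + y ^ q) ^ (1 / p) * (1 + (y * s) ^ q) ^ (-(1 / p)) := by
  have hy := hx.trans hxy
  rw [rescaled_integrand_eq_div_rpow p hx hs, rescaled_integrand_eq_div_rpow p hy hs]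
  refine Real.rpow_le_rpow (by positivity) ?_ (by positivity)
  rw [div_le_div_iff₀ (by positivity) (by positivity)]
  nlinarith [mul_nonneg (sub_nonneg.2 (Real.rpow_lt_rpow hx.le hxy hq).le)
    (sub_nonneg.2 (Real.rpow_le_one hs hs1 hq.le))]

theorem rescaled_integrand_lt {p q x y s : ℝ} (hp : 0 < p) (hq : 0 < q) (hx : 0 < x)
    (hxy : x < y) (hs : 0 ≤ s) (hs1 : s < 1) :
    (1 + x ^ q) ^ (1 / p) * (1 + (x * s) ^ q) ^ (-(1 / p)) <
      (1 + y ^ q) ^ (1 / p) * (1 + (y * s) ^ q) ^ (-(1 / p)) := by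
  have hy := hx.trans hxy
  rw [rescaled_integrand_eq_div_rpow p hx hs, rescaled_integrand_eq_div_rpow p hy hs]
  refine Real.rpow_lt_rpow (by positivity) ?_ (by positivity)
  rw [div_lt_div_iff₀ (by positivity) (by positivity)]
  nlinarith [mul_pos (sub_pos.2 (Real.rpow_lt_rpow hx.le hxy hq))
    (sub_pos.2 (Real.rpow_lt_one hs hs1 hq))]

theorem integral_rescaled_integrand_pos (p : ℝ) {q x : ℝ} (hq : 0 < q) (hx : 0 < x) :
    0 < ∫ s in (0:ℝ)..1, (1 + x ^ q) ^ (1 / p) * (1 + (x * s) ^ q) ^ (-(1 / p)) := by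
  refine intervalIntegral.intervalIntegral_pos_of_pos_on ?_ ?_ one_pos
  · exact ContinuousOn.intervalIntegrable_of_Icc zero_le_one
      (continuousOn_rescaled_integrand p hq hx)
  · intro s hs
    have := hs.1
    positivity

theorem integral_rescaled_integrand_lt {p q x y : ℝ} (hp : 0 < p) (hq : 0 < q) (hx : 0 < x)
    (hxy : x < y) :
    (∫ s in (0:ℝ)..1, (1 + x ^ q) ^ (1 / p) * (1 + (x * s) ^ q) ^ (-(1 / p))) <
      ∫ s in (0:ℝ)..1, (1 + y ^ q) ^ (1 / p) * (1 + (y * s) ^ q) ^ (-(1 / p)) :=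
  intervalIntegral.integral_lt_integral_of_continuousOn_of_le_of_exists_lt one_pos
    (continuousOn_rescaled_integrand p hq hx)
    (continuousOn_rescaled_integrand p hq (hx.trans hxy))
    (fun _ hs => rescaled_integrand_le hp hq hx hxy hs.1.le hs.2)
    ⟨0, ⟨le_rfl, zero_le_one⟩, rescaled_integrand_lt hp hq hx hxy le_rfl one_pos⟩

/-- For `p, q ∈ (1, ∞)` and `p₂ ≥ 0`, the function
`F*(x) = x^(1-p₂) / (arcsinh_{p,q}(x) · (1 + x^q)^(1/p))` is strictly decreasing
on `(0, ∞)`, where `arcsinh_{p,q}(x) = ∫₀ˣ (1 + t^q)^(-1/p) dt`. -/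
theorem Fstar_strictAntiOn (p q : ℝ) (hp : 1 < p) (hq : 1 < q) (p₂ : ℝ) (hp₂ : 0 ≤ p₂) :
    StrictAntiOn
      (fun x : ℝ => x ^ (1 - p₂) /
        ((∫ t in (0:ℝ)..x, (1 + t ^ q) ^ (-(1 / p))) * (1 + x ^ q) ^ (1 / p)))
      (Set.Ioi (0 : ℝ)) := by
  have hp0 : 0 < p := one_pos.trans hp
  have hq0 : 0 < q := one_pos.trans hq
  intro x (hx : 0 < x) y (hy : 0 < y) hxy
  have hIx := integral_rescaled_integrand_pos p hq0 hx
  have hIlt := integral_rescaled_integrand_lt hp0 hq0 hx hxy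
  have key : ∀ z : ℝ, 0 < z → ∀ I : ℝ, z ^ (1 - p₂) / (z * I) = 1 / (z ^ p₂ * I) := by
    intro z hz I
    rw [Real.rpow_sub hz, Real.rpow_one, div_div, mul_left_comm, ← div_div, div_self hz.ne']
  beta_reduce
  rw [arcsinh_mul_eq_mul_integral, arcsinh_mul_eq_mul_integral, key x hx, key y hy]
  refine one_div_lt_one_div_of_lt (mul_pos (Real.rpow_pos_of_pos hx p₂) hIx) ?_
  exact mul_lt_mul' (Real.rpow_le_rpow hx.le hxy.le hp₂) hIlt hIx.le
    (Real.rpow_pos_of_pos hy p₂)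
end

section
/- Let p, q ∈ (1, ∞). Then the function G*(x) = x / (arcsinh_{p,q}(x) · (1 + x^q)^{1/p}) + q·x^q / (p·(1 + x^q)) satisfies G*(x) > 1 for all x ∈ (0, ∞). -/
open MeasureTheory Set

/-- The derivative of `t ↦ t (1 + t^q)^(-a)` on the positive half-line. -/
lemma hasDerivAt_id_mul_one_add_rpow (a q t : ℝ) (ht : 0 < t) :
    HasDerivAt (fun t : ℝ => t * (1 + t ^ q) ^ (-a))
      ((1 + t ^ q) ^ (-a) * (1 - a * q * (t ^ q / (1 + t ^ q)))) t := by
  have hpos : 0 < 1 + t ^ q := by positivity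
  have h := (hasDerivAt_id t).mul
    (((Real.hasDerivAt_rpow_const (p := q) (Or.inl ht.ne')).const_add 1).rpow_const
      (p := -a) (Or.inl hpos.ne'))
  refine h.congr_deriv ?_
  rw [Real.rpow_sub_one hpos.ne', Real.rpow_sub_one ht.ne']
  simp only [id]
  field_simp
  ring

/-- For `a, q > 0`, the mean of `(1 + t^q)^(-a) (1 - a q t^q / (1 + t^q))` over `[0, x]` exceeds
what the decreasing second factor gives at its right endpoint. -/
lemma mul_integral_lt_mul_one_add_rpow {a q x : ℝ} (ha : 0 < a) (hq : 0 < q) (hx : 0 < x) :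
    (1 - a * q * (x ^ q / (1 + x ^ q))) * (∫ t in (0:ℝ)..x, (1 + t ^ q) ^ (-a)) <
      x * (1 + x ^ q) ^ (-a) := by
  have hpos : ∀ t ∈ Icc 0 x, 0 < 1 + t ^ q := fun t ht => by
    have := Real.rpow_nonneg ht.1 q
    positivity
  have hpow : ContinuousOn (fun t : ℝ => t ^ q) (Icc 0 x) :=
    (Real.continuous_rpow_const hq.le).continuousOn
  have hbase : ContinuousOn (fun t : ℝ => 1 + t ^ q) (Icc 0 x) := continuousOn_const.add hpow
  have hf : ContinuousOn (fun t : ℝ => (1 + t ^ q) ^ (-a)) (Icc 0 x) :=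
    hbase.rpow_const fun t ht => Or.inl (hpos t ht).ne'
  have hg : ContinuousOn
      (fun t : ℝ => (1 + t ^ q) ^ (-a) * (1 - a * q * (t ^ q / (1 + t ^ q)))) (Icc 0 x) :=
    hf.mul (continuousOn_const.sub
      (continuousOn_const.mul (hpow.div hbase fun t ht => (hpos t ht).ne')))
  have hFTC : ∫ t in (0:ℝ)..x, (1 + t ^ q) ^ (-a) * (1 - a * q * (t ^ q / (1 + t ^ q))) =
      x * (1 + x ^ q) ^ (-a) := by
    rw [intervalIntegral.integral_eq_sub_of_hasDerivAt_of_le hx.le (continuousOn_id.mul hf)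
      (fun t ht => hasDerivAt_id_mul_one_add_rpow a q t ht.1)
      (hg.intervalIntegrable_of_Icc hx.le)]
    simp
  have hmono : ∀ t, 0 ≤ t → t < x → t ^ q / (1 + t ^ q) < x ^ q / (1 + x ^ q) := by
    intro t h0 htx
    have h1 := Real.rpow_lt_rpow h0 htx hq
    have h2 := Real.rpow_nonneg h0 q
    rw [div_lt_div_iff₀ (by positivity) (by positivity)]
    linarith
  have hlt : ∀ t ∈ Icc 0 x, t < x →
      (1 - a * q * (x ^ q / (1 + x ^ q))) * (1 + t ^ q) ^ (-a) <
        (1 + t ^ q) ^ (-a) * (1 - a * q * (t ^ q / (1 + t ^ q))) := by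
    intro t ht htx
    rw [mul_comm]
    have := hpos t ht
    have := hmono t ht.1 htx
    gcongr
  rw [← hFTC, ← intervalIntegral.integral_const_mul]
  refine intervalIntegral.integral_lt_integral_of_continuousOn_of_le_of_exists_lt hx
    (continuousOn_const.mul hf) hg (fun t ht => ?_)
    ⟨0, ⟨le_rfl, hx.le⟩, hlt 0 ⟨le_rfl, hx.le⟩ hx⟩
  rcases ht.2.lt_or_eq with h | rfl
  · exact (hlt t ⟨ht.1.le, ht.2⟩ h).le
  · rw [mul_comm]

/-- For `p, q ∈ (1, ∞)`, the function
`G*(x) = x / (arcsinh_{p,q}(x) · (1 + x^q)^(1/p)) + q x^q / (p (1 + x^q))`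
satisfies `G*(x) > 1` for all `x ∈ (0, ∞)`. -/
theorem Gstar_gt_one (p q : ℝ) (hp : 1 < p) (hq : 1 < q) (x : ℝ) (hx : 0 < x) :
    1 < x / ((∫ t in (0:ℝ)..x, (1 + t ^ q) ^ (-(1 / p))) * (1 + x ^ q) ^ (1 / p)) +
        q * x ^ q / (p * (1 + x ^ q)) := by
  have hp0 : 0 < p := by linarith
  have hq0 : 0 < q := by linarith
  have hpos : 0 < 1 + x ^ q := by positivity
  have hI : 0 < ∫ t in (0:ℝ)..x, (1 + t ^ q) ^ (-(1 / p)) := by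
    have hbase : ∀ t ∈ Icc 0 x, 0 < 1 + t ^ q := fun t ht => by
      have := Real.rpow_nonneg ht.1 q
      positivity
    refine intervalIntegral.intervalIntegral_pos_of_pos_on
      (ContinuousOn.intervalIntegrable_of_Icc hx.le ?_)
      (fun t ht => Real.rpow_pos_of_pos (hbase t ⟨ht.1.le, ht.2.le⟩) _) hx
    exact (continuousOn_const.add (Real.continuous_rpow_const hq0.le).continuousOn).rpow_const
      fun t ht => Or.inl (hbase t ht).ne'
  have key := mul_integral_lt_mul_one_add_rpow (one_div_pos.2 hp0) hq0 hx
  rw [← lt_div_iff₀ hI] at key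
  have h1 : x / ((∫ t in (0:ℝ)..x, (1 + t ^ q) ^ (-(1 / p))) * (1 + x ^ q) ^ (1 / p)) =
      x * (1 + x ^ q) ^ (-(1 / p)) / ∫ t in (0:ℝ)..x, (1 + t ^ q) ^ (-(1 / p)) := by
    rw [Real.rpow_neg hpos.le (1 / p), ← div_eq_mul_inv, div_div, mul_comm]
  have h2 : q * x ^ q / (p * (1 + x ^ q)) = 1 / p * q * (x ^ q / (1 + x ^ q)) := by
    field_simp
  rw [h1, h2]
  linarith
end

section
/- Let p, q ∈ (1, ∞). Then G*(x) = x / (arcsinh_{p,q}(x) · (1 + x^q)^{1/p}) + q·x^q / (p·(1 + x^q)) satisfies lim_{x → 0⁺} G*(x) = 1, and consequently the infimum of G* over (0, ∞) equals 1. -/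
open MeasureTheory Set Filter

lemma intervalIntegrable_one_add_rpow {q x : ℝ} (hq : 1 < q) (r : ℝ) (hx : 0 ≤ x) :
    IntervalIntegrable (fun t : ℝ => (1 + t ^ q) ^ (-r)) volume 0 x := by
  refine ContinuousOn.intervalIntegrable ?_
  rw [uIcc_of_le hx]
  have hc : Continuous fun t : ℝ => t ^ q := Real.continuous_rpow_const (by linarith)
  refine (continuous_const.add hc).continuousOn.rpow_const fun t ht => Or.inl ?_
  have := Real.rpow_nonneg ht.1 q
  exact (by positivity : 0 < 1 + t ^ q).ne'

/-- Lower bound `x (1 + x^q)^(-r) ≤ ∫₀ˣ (1 + t^q)^(-r)`, from monotonicity of the integrand. -/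
lemma mul_rpow_le_integral {q r x : ℝ} (hq : 1 < q) (hr : 0 < r) (hx : 0 < x) :
    x * (1 + x ^ q) ^ (-r) ≤ ∫ t in (0:ℝ)..x, (1 + t ^ q) ^ (-r) := by
  have hint := intervalIntegrable_one_add_rpow hq r hx.le
  have h := intervalIntegral.integral_mono_on hx.le
    (intervalIntegrable_const (μ := volume) (c := (1 + x ^ q) ^ (-r))) hint fun t ht =>
      Real.rpow_le_rpow_of_nonpos (by have := Real.rpow_nonneg ht.1 q; positivity)
        (by gcongr; exacts [ht.1, ht.2]) (by linarith)
  simpa using h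

lemma hasDerivAt_mul_one_add_rpow {q r t : ℝ} (hq : 1 < q) (ht : 0 ≤ t) :
    HasDerivAt (fun t : ℝ => t * (1 + t ^ q) ^ (-r))
      ((1 - r * q * (t ^ q / (1 + t ^ q))) * (1 + t ^ q) ^ (-r)) t := by
  have hu : 0 < 1 + t ^ q := by have := Real.rpow_nonneg ht q; positivity
  have h := (hasDerivAt_id t).mul
    (((Real.hasDerivAt_rpow_const (x := t) (p := q) (Or.inr hq.le)).const_add 1).rpow_const
      (p := -r) (Or.inl hu.ne'))
  refine h.congr_deriv ?_
  have h1 : t * t ^ (q - 1) = t ^ q := by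
    rw [mul_comm, ← Real.rpow_add_one' ht (by linarith)]
    ring_nf
  rw [Real.rpow_sub_one hu.ne']
  simp only [id, ← h1] at hu ⊢
  field_simp
  ring

/-- Integrating the derivative of `t (1 + t^q)^(-r)` and bounding its decreasing factor from
below by the value at `x`. -/
lemma mul_integral_le_mul_rpow {q r x : ℝ} (hq : 1 < q) (hr : 0 < r) (hx : 0 < x) :
    (1 - r * q * (x ^ q / (1 + x ^ q))) * (∫ t in (0:ℝ)..x, (1 + t ^ q) ^ (-r)) ≤
      x * (1 + x ^ q) ^ (-r) := by
  have hint := intervalIntegrable_one_add_rpow hq r hx.le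
  have hu : ∀ t ∈ Icc 0 x, 0 < 1 + t ^ q := fun t ht => by
    have := Real.rpow_nonneg ht.1 q
    positivity
  have hcont : ContinuousOn (fun t : ℝ => 1 - r * q * (t ^ q / (1 + t ^ q))) (uIcc 0 x) := by
    rw [uIcc_of_le hx.le]
    have hc : Continuous fun t : ℝ => t ^ q := Real.continuous_rpow_const (by linarith)
    exact continuousOn_const.sub (continuousOn_const.mul
      (hc.continuousOn.div (continuous_const.add hc).continuousOn fun t ht => (hu t ht).ne'))
  have hint' := hint.continuousOn_mul hcont
  have hftc := intervalIntegral.integral_eq_sub_of_hasDerivAt (a := 0) (b := x)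
    (fun t ht => hasDerivAt_mul_one_add_rpow (r := r) hq
      (by rw [uIcc_of_le hx.le] at ht; exact ht.1)) hint'
  rw [zero_mul, sub_zero] at hftc
  rw [← hftc, ← intervalIntegral.integral_const_mul]
  refine intervalIntegral.integral_mono_on hx.le (hint.const_mul _) hint' fun t ht => ?_
  have hle : t ^ q ≤ x ^ q := Real.rpow_le_rpow ht.1 ht.2 (by linarith)
  have hux := hu x ⟨hx.le, le_rfl⟩
  have hut := hu t ht
  have hdiv : t ^ q / (1 + t ^ q) ≤ x ^ q / (1 + x ^ q) := by
    rw [div_le_div_iff₀ hut hux]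
    linarith
  gcongr

/-- For `p, q ∈ (1, ∞)`, the function
`G*(x) = x / (arcsinh_{p,q}(x) · (1 + x^q)^(1/p)) + q x^q / (p (1 + x^q))`
tends to `1` as `x → 0⁺`, and its infimum over `(0, ∞)` equals `1`. -/
theorem Gstar_limit_and_inf (p q : ℝ) (hp : 1 < p) (hq : 1 < q) :
    Filter.Tendsto
        (fun x : ℝ => x / ((∫ t in (0:ℝ)..x, (1 + t ^ q) ^ (-(1 / p))) *
            (1 + x ^ q) ^ (1 / p)) + q * x ^ q / (p * (1 + x ^ q)))
        (nhdsWithin 0 (Set.Ioi (0 : ℝ))) (nhds 1) ∧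
      sInf ((fun x : ℝ => x / ((∫ t in (0:ℝ)..x, (1 + t ^ q) ^ (-(1 / p))) *
            (1 + x ^ q) ^ (1 / p)) + q * x ^ q / (p * (1 + x ^ q))) ''
          Set.Ioi (0 : ℝ)) = 1 := by
  have hr : 0 < 1 / p := by positivity
  have hbd : ∀ x ∈ Ioi (0 : ℝ),
      1 ≤ x / ((∫ t in (0:ℝ)..x, (1 + t ^ q) ^ (-(1 / p))) * (1 + x ^ q) ^ (1 / p)) +
          q * x ^ q / (p * (1 + x ^ q)) ∧
        x / ((∫ t in (0:ℝ)..x, (1 + t ^ q) ^ (-(1 / p))) * (1 + x ^ q) ^ (1 / p)) +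
          q * x ^ q / (p * (1 + x ^ q)) ≤ 1 + q * x ^ q / (p * (1 + x ^ q)) := by
    intro x hx
    have hx : 0 < x := hx
    have hlow := mul_rpow_le_integral hq hr hx
    have hupp := mul_integral_le_mul_rpow hq hr hx
    have hu : 0 < 1 + x ^ q := by positivity
    have hA := lt_of_lt_of_le (by positivity) hlow
    have hxA : x / ((∫ t in (0:ℝ)..x, (1 + t ^ q) ^ (-(1 / p))) * (1 + x ^ q) ^ (1 / p)) =
        x * (1 + x ^ q) ^ (-(1 / p)) / ∫ t in (0:ℝ)..x, (1 + t ^ q) ^ (-(1 / p)) := by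
      rw [Real.rpow_neg hu.le (1 / p)]
      field_simp
    have hqx : q * x ^ q / (p * (1 + x ^ q)) = 1 / p * q * (x ^ q / (1 + x ^ q)) := by
      field_simp
    rw [hxA, hqx]
    constructor
    · linarith [(le_div_iff₀ hA).2 hupp]
    · linarith [(div_le_one hA).2 hlow]
  have hlim : Tendsto (fun x : ℝ => 1 + q * x ^ q / (p * (1 + x ^ q)))
      (nhdsWithin 0 (Ioi 0)) (nhds 1) := by
    have hc : ContinuousAt (fun x : ℝ => x ^ q) 0 :=
      Real.continuousAt_rpow_const 0 q (Or.inr (by linarith))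
    have h0 : (0 : ℝ) ^ q = 0 := Real.zero_rpow (by linarith)
    have h : ContinuousAt (fun x : ℝ => 1 + q * x ^ q / (p * (1 + x ^ q))) 0 :=
      continuousAt_const.add ((continuousAt_const.mul hc).div
        (continuousAt_const.mul (continuousAt_const.add hc)) (by rw [h0]; simp; linarith))
    have h' := h.tendsto
    simp only [h0, mul_zero, zero_div, add_zero] at h'
    exact h'.mono_left nhdsWithin_le_nhds
  have htend := tendsto_of_tendsto_of_tendsto_of_le_of_le' tendsto_const_nhds hlim
    (eventually_mem_nhdsWithin.mono fun x hx => (hbd x hx).1)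
    (eventually_mem_nhdsWithin.mono fun x hx => (hbd x hx).2)
  refine ⟨htend, le_antisymm ?_ ?_⟩
  · refine ge_of_tendsto htend (eventually_mem_nhdsWithin.mono fun x hx => ?_)
    exact csInf_le ⟨1, forall_mem_image.2 fun y hy => (hbd y hy).1⟩ (mem_image_of_mem _ hx)
  · exact le_csInf (nonempty_Ioi.image _) (forall_mem_image.2 fun y hy => (hbd y hy).1)
end

section
/- Let p, q ∈ (1, ∞), let r, s ∈ (0, m*_{p,q}) where m*_{p,q} = ∫₀^∞ (1 + t^q)^{-1/p} dt, and let x, y, u ∈ (0, ∞) satisfy arcsinh_{p,q}(x) = r, arcsinh_{p,q}(y) = s, and arcsinh_{p,q}(u) = √(r·s). Then u ≤ √(x·y). (Equivalently, sinh_{p,q}(√(r·s)) ≤ √(sinh_{p,q}(r) · sinh_{p,q}(s)) for all r, s ∈ (0, m*_{p,q}).) -/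
open MeasureTheory Set

open intervalIntegral in
/-- A function whose dilation ratio `f (l * t) / f t` is antitone in `t` has a primitive
with the same property. -/
theorem integral_dilation_ratio_le {f : ℝ → ℝ} (hf : Continuous f) (hpos : ∀ t, 0 ≤ t → 0 < f t)
    {l : ℝ} (hl : 0 < l)
    (hmono : ∀ a b, 0 ≤ a → a ≤ b → f (l * b) * f a ≤ f (l * a) * f b)
    {x z : ℝ} (hx : 0 ≤ x) (hxz : x ≤ z) :
    (∫ t in (0:ℝ)..l * z, f t) * (∫ t in (0:ℝ)..x, f t) ≤
      (∫ t in (0:ℝ)..z, f t) * (∫ t in (0:ℝ)..l * x, f t) := by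
  have hdil : ∀ w, (∫ t in (0:ℝ)..l * w, f t) = l * ∫ t in (0:ℝ)..w, f (l * t) := by
    intro w
    rw [mul_integral_comp_mul_left, mul_zero]
  have hg : Continuous fun t => f (l * t) := hf.comp (continuous_const_mul l)
  have hfi : ∀ a b, IntervalIntegrable f volume a b := fun a b => hf.intervalIntegrable a b
  have hgi : ∀ a b, IntervalIntegrable (fun t => f (l * t)) volume a b :=
    fun a b => hg.intervalIntegrable a b
  have upper : (∫ t in x..z, f (l * t)) * f x ≤ f (l * x) * ∫ t in x..z, f t := by
    rw [← intervalIntegral.integral_mul_const, ← intervalIntegral.integral_const_mul]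
    exact integral_mono_on hxz ((hgi _ _).mul_const _) ((hfi _ _).const_mul _)
      fun t ht => hmono x t hx ht.1
  have lower : f (l * x) * (∫ t in (0:ℝ)..x, f t) ≤ (∫ t in (0:ℝ)..x, f (l * t)) * f x := by
    rw [← intervalIntegral.integral_mul_const, ← intervalIntegral.integral_const_mul]
    exact integral_mono_on hx ((hfi _ _).const_mul _) ((hgi _ _).mul_const _)
      fun t ht => hmono t x ht.1 ht.2
  have hB : 0 ≤ ∫ t in x..z, f t :=
    integral_nonneg hxz fun t ht => (hpos t (hx.trans ht.1)).le
  have hC : 0 ≤ ∫ t in (0:ℝ)..x, f t := integral_nonneg hx fun t ht => (hpos t ht.1).le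
  have hfx := hpos x hx
  rw [hdil, hdil, ← integral_add_adjacent_intervals (hfi 0 x) (hfi x z),
    ← integral_add_adjacent_intervals (hgi 0 x) (hgi x z)]
  set A := ∫ t in x..z, f (l * t)
  set B := ∫ t in x..z, f t
  set C := ∫ t in (0:ℝ)..x, f t
  set D := ∫ t in (0:ℝ)..x, f (l * t)
  have key : A * C ≤ B * D := by
    refine le_of_mul_le_mul_right ?_ hfx
    nlinarith [mul_le_mul_of_nonneg_right upper hC, mul_le_mul_of_nonneg_left lower hB]
  nlinarith [mul_le_mul_of_nonneg_left key hl.le]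

/-- The integrand `(1 + t ^ q) ^ (-(1 / p))` has antitone dilation ratios. -/
theorem arcsinh_pq_integrand_dilation {p q : ℝ} (hp : 0 < p) (hq : 0 < q) {l : ℝ} (hl : 1 ≤ l)
    {a b : ℝ} (ha : 0 ≤ a) (hab : a ≤ b) :
    (1 + (l * b) ^ q) ^ (-(1 / p)) * (1 + a ^ q) ^ (-(1 / p)) ≤
      (1 + (l * a) ^ q) ^ (-(1 / p)) * (1 + b ^ q) ^ (-(1 / p)) := by
  have hb : 0 ≤ b := ha.trans hab
  have hl0 : 0 ≤ l := zero_le_one.trans hl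
  have hL : 1 ≤ l ^ q := Real.one_le_rpow hl hq.le
  have hAB : a ^ q ≤ b ^ q := Real.rpow_le_rpow ha hab hq.le
  have hA : 0 ≤ a ^ q := Real.rpow_nonneg ha q
  have hB : 0 ≤ b ^ q := Real.rpow_nonneg hb q
  rw [Real.mul_rpow hl0 hb, Real.mul_rpow hl0 ha,
    ← Real.mul_rpow (z := -(1 / p)) (by positivity) (by positivity),
    ← Real.mul_rpow (z := -(1 / p)) (by positivity) (by positivity)]
  have hexp : -(1 / p) ≤ 0 := neg_nonpos.2 (by positivity)
  refine Real.rpow_le_rpow_of_nonpos (by positivity) ?_ hexp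
  nlinarith [mul_nonneg (sub_nonneg.2 hL) (sub_nonneg.2 hAB)]

/-- A primitive of a positive function with antitone dilation ratios is geometrically concave. -/
theorem integral_mul_le_sq_integral_sqrt {f : ℝ → ℝ} (hf : Continuous f) (hpos : ∀ t, 0 ≤ t → 0 < f t)
    (hmono : ∀ l, 1 ≤ l → ∀ a b, 0 ≤ a → a ≤ b → f (l * b) * f a ≤ f (l * a) * f b)
    {x y : ℝ} (hx : 0 < x) (hxy : x ≤ y) :
    (∫ t in (0:ℝ)..x, f t) * (∫ t in (0:ℝ)..y, f t) ≤
      (∫ t in (0:ℝ)..Real.sqrt (x * y), f t) ^ 2 := by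
  have hy : 0 < y := hx.trans_le hxy
  have hz : Real.sqrt (x * y) * Real.sqrt (x * y) = x * y := Real.mul_self_sqrt (by positivity)
  have hxz : x ≤ Real.sqrt (x * y) := Real.le_sqrt_of_sq_le (by nlinarith)
  set z := Real.sqrt (x * y)
  have hl : 1 ≤ z / x := (one_le_div hx).2 hxz
  have h := integral_dilation_ratio_le hf hpos (zero_lt_one.trans_le hl) (hmono _ hl) hx.le hxz
  have e1 : z / x * z = y := by
    field_simp
    linarith
  have e2 : z / x * x = z := by field_simp
  rw [e1, e2] at h
  linarith

/-- Theorem 1.1(2): for `p, q ∈ (1, ∞)` and `r, s ∈ (0, m*_{p,q})`, where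
`m*_{p,q} = ∫₀^∞ (1 + t^q)^(-1/p) dt` (possibly `+∞`, computed here as a
Lebesgue integral in `ℝ≥0∞`), if `x, y, u ∈ (0, ∞)` satisfy
`arcsinh_{p,q}(x) = r`, `arcsinh_{p,q}(y) = s` and `arcsinh_{p,q}(u) = √(r s)`,
then `u ≤ √(x y)`, i.e. `sinh_{p,q}(√(r s)) ≤ √(sinh_{p,q}(r) · sinh_{p,q}(s))`. -/
theorem sinh_pq_geom_mean (p q : ℝ) (hp : 1 < p) (hq : 1 < q)
    (r s : ℝ) (hr0 : 0 < r) (hs0 : 0 < s)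
    (hr : ENNReal.ofReal r <
      ∫⁻ t in Set.Ioi (0 : ℝ), ENNReal.ofReal ((1 + t ^ q) ^ (-(1 / p))))
    (hs : ENNReal.ofReal s <
      ∫⁻ t in Set.Ioi (0 : ℝ), ENNReal.ofReal ((1 + t ^ q) ^ (-(1 / p))))
    (x y u : ℝ) (hx : 0 < x) (hy : 0 < y) (hu : 0 < u)
    (hxr : (∫ t in (0:ℝ)..x, (1 + t ^ q) ^ (-(1 / p))) = r)
    (hys : (∫ t in (0:ℝ)..y, (1 + t ^ q) ^ (-(1 / p))) = s)
    (hurs : (∫ t in (0:ℝ)..u, (1 + t ^ q) ^ (-(1 / p))) = Real.sqrt (r * s)) :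
    u ≤ Real.sqrt (x * y) := by
  let f : ℝ → ℝ := fun t => (1 + |t| ^ q) ^ (-(1 / p))
  have hf_eq : ∀ t, 0 ≤ t → f t = (1 + t ^ q) ^ (-(1 / p)) := fun t ht => by
    simp only [f, abs_of_nonneg ht]
  have hbase : ∀ t : ℝ, 0 < 1 + |t| ^ q := fun t => by positivity
  have hf : Continuous f :=
    (continuous_const.add (continuous_abs.rpow_const fun _ => Or.inr (by linarith))).rpow_const
      fun t => Or.inl (hbase t).ne'
  have hpos : ∀ t, 0 < f t := fun t => Real.rpow_pos_of_pos (hbase t) _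
  have hint : ∀ w, 0 ≤ w →
      (∫ t in (0:ℝ)..w, (1 + t ^ q) ^ (-(1 / p))) = ∫ t in (0:ℝ)..w, f t := by
    intro w hw
    refine intervalIntegral.integral_congr fun t ht => ?_
    rw [uIcc_of_le hw] at ht
    exact (hf_eq t ht.1).symm
  have hmono : ∀ l, 1 ≤ l → ∀ a b, 0 ≤ a → a ≤ b → f (l * b) * f a ≤ f (l * a) * f b := by
    intro l hl a b ha hab
    have hb := ha.trans hab
    rw [hf_eq _ ha, hf_eq _ hb, hf_eq (l * b) (by positivity), hf_eq (l * a) (by positivity)]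
    exact arcsinh_pq_integrand_dilation (by linarith) (by linarith) hl ha hab
  rw [hint _ hx.le] at hxr
  rw [hint _ hy.le] at hys
  rw [hint _ hu.le] at hurs
  have key : r * s ≤ (∫ t in (0:ℝ)..Real.sqrt (x * y), f t) ^ 2 := by
    rw [← hxr, ← hys]
    rcases le_total x y with h | h
    · exact integral_mul_le_sq_integral_sqrt hf (fun t _ => hpos t) hmono hx h
    · rw [mul_comm, mul_comm x y]
      exact integral_mul_le_sq_integral_sqrt hf (fun t _ => hpos t) hmono hy h
  have hFz : 0 ≤ ∫ t in (0:ℝ)..Real.sqrt (x * y), f t :=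
    intervalIntegral.integral_nonneg (Real.sqrt_nonneg _) fun t _ => (hpos t).le
  by_contra! hlt
  have hgap : 0 < ∫ t in Real.sqrt (x * y)..u, f t :=
    intervalIntegral.intervalIntegral_pos_of_pos (hf.intervalIntegrable _ _) hpos hlt
  have hsplit := intervalIntegral.integral_add_adjacent_intervals
    (hf.intervalIntegrable (μ := volume) 0 (Real.sqrt (x * y)))
    (hf.intervalIntegrable (μ := volume) (Real.sqrt (x * y)) u)
  have hle := (Real.sqrt_le_left hFz).2 key
  linarith
end
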